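/- Let f ∈ AP(ℍ) with f(z) ≠ 0 for all z ∈ ℍ. Then inf_{ε < Im z < 1/ε} |f(z)| > 0 for every ε > 0, and 1/f ∈ AP(ℍ). Moreover, if spec(f) is bounded from below then spec(1/f) is bounded from below, and if in addition spec(f) is locally finite then spec(1/f) is locally finite. -/

import Mathlib

open MeasureTheory Complex Filter Topology Set
open scoped ENNReal

noncomputable section

/-- The open upper half-plane, as a subset of `ℂ`. -/
def UHP : Set ℂ := {z : ℂ | 0 < z.im}

/-- A relatively dense subset of `ℝ`. -/
def RelDense (τ : Set ℝ) : Prop := ∃ l > (0:ℝ), ∀ x : ℝ, ∃ t ∈ τ, x < t ∧ t < x + l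

/-- Bohr almost periodic continuous functions on `ℝ`. -/
def APR (f : ℝ → ℂ) : Prop :=
  Continuous f ∧ ∀ ε > (0:ℝ), RelDense {t : ℝ | ∀ x : ℝ, ‖f x - f (x + t)‖ ≤ ε}

/-- Holomorphic almost periodic functions on the upper half-plane. -/
def APH (f : ℂ → ℂ) : Prop :=
  DifferentiableOn ℂ f UHP ∧
  ∀ α β ε : ℝ, 0 < α → α < β → 0 < ε →
    ∃ τ : Set ℝ, RelDense τ ∧
      ∀ t ∈ τ, ∀ z : ℂ, α < z.im → z.im < β → ‖f z - f (z + (t : ℂ))‖ ≤ ε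

/-- `HasMeanAt f y lam c` : the mean `(1/2T)∫_{-T+iy}^{T+iy} f(z) e^{-2πiλz} dz` tends to `c`. -/
def HasMeanAt (f : ℂ → ℂ) (y lam : ℝ) (c : ℂ) : Prop :=
  Tendsto (fun T : ℝ => (1 / (2 * (T : ℂ))) *
      ∫ x in (-T)..T, f ((x : ℂ) + (y : ℂ) * Complex.I) *
        Complex.exp (-(2 * (Real.pi : ℂ) * Complex.I * (lam : ℂ) * ((x : ℂ) + (y : ℂ) * Complex.I))))
    atTop (𝓝 c)

/-- `HasMeanR f lam c` : the Bohr mean `(1/2T)∫_{-T}^{T} f(x) e^{-2πiλx} dx` tends to `c`. -/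
def HasMeanR (f : ℝ → ℂ) (lam : ℝ) (c : ℂ) : Prop :=
  Tendsto (fun T : ℝ => (1 / (2 * (T : ℂ))) *
      ∫ x in (-T)..T, f x *
        Complex.exp (-(2 * (Real.pi : ℂ) * Complex.I * (lam : ℂ) * (x : ℂ))))
    atTop (𝓝 c)

/-- The spectrum of a function on the upper half-plane: frequencies where the mean is not `0`. -/
def specH (f : ℂ → ℂ) : Set ℝ := {lam : ℝ | ∃ y > (0:ℝ), ¬ HasMeanAt f y lam 0}

/-- A locally finite subset of `ℝ`. -/
def LocFinSet (S : Set ℝ) : Prop := ∀ a b : ℝ, (S ∩ Set.Ioo a b).Finite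

/-- A uniformly discrete subset of `ℝ`. -/
def UnifDiscrete (S : Set ℝ) : Prop :=
  ∃ d > (0:ℝ), ∀ x ∈ S, ∀ y ∈ S, x ≠ y → d ≤ |x - y|

/-- Locally summable coefficient functions. -/
def LocSummable (a : ℝ → ℂ) : Prop :=
  (Function.support a).Countable ∧
  ∀ T > (0:ℝ), Summable (Set.indicator (Set.Icc (-T) T) fun l => ‖a l‖)

/-- Exponential growth of a coefficient function. -/
def ExpGrowth (a : ℝ → ℂ) : Prop :=
  ∃ c > (0:ℝ), Summable fun lam : ℝ => ‖a lam‖ * Real.exp (-c * |lam|)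

/-- `a(-λ) = conj (a(λ))`. -/
def Antipodal (a : ℝ → ℂ) : Prop := ∀ lam : ℝ, a (-lam) = (starRingEnd ℂ) (a lam)

/-- The Fourier transform `φ̂(ξ) = ∫ φ(x) e^{-2πixξ} dx`. -/
def FT (φ : ℝ → ℂ) (ξ : ℝ) : ℂ :=
  ∫ x : ℝ, φ x * Complex.exp (-(2 * (Real.pi : ℂ) * Complex.I * (x : ℂ) * (ξ : ℂ)))

/-- A complex-valued measure on `ℝ`, encoded by its total variation `ν` together with a
unimodular density `w`, so that `dμ = w dν` and `|μ| = ν`. -/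
structure CMeasure where
  ν : Measure ℝ
  w : ℝ → ℂ
  meas : Measurable w
  unit : ∀ᵐ t ∂ν, ‖w t‖ = 1

/-- Integration against a complex measure. -/
def CMeasure.integral (μ : CMeasure) (φ : ℝ → ℂ) : ℂ := ∫ t, φ t * μ.w t ∂μ.ν

/-- Strongly tempered: every Schwartz function is `|μ|`-integrable. -/
def CMeasure.IsStronglyTempered (μ : CMeasure) : Prop :=
  ∀ φ : SchwartzMap ℝ ℂ, Integrable (fun t => φ t) μ.ν

/-- Real-valued complex measure. -/
def CMeasure.RealValued (μ : CMeasure) : Prop := ∀ᵐ t ∂μ.ν, (μ.w t).im = 0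

/-- Nonnegative complex measure. -/
def CMeasure.Nonneg (μ : CMeasure) : Prop := ∀ᵐ t ∂μ.ν, μ.w t = 1

/-- `deg(μ) ≤ n` : `∫ (1+t²)^{-n/2} d|μ| < ∞`. -/
def CMeasure.DegLE (μ : CMeasure) (n : ℕ) : Prop :=
  Integrable (fun t : ℝ => (1 + t ^ 2) ^ (-(n : ℝ) / 2)) μ.ν

/-- The mass `μ({x})` of an atom. -/
def CMeasure.atom (μ : CMeasure) (x : ℝ) : ℂ := ∫ t in {x}, μ.w t ∂μ.ν

/-- The (closed) support of a measure on `ℝ`. -/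
def measSupport (ν : Measure ℝ) : Set ℝ := {x : ℝ | ∀ U ∈ 𝓝 x, ν U ≠ 0}

/-- `(μ, a)` is a Fourier summation pair. -/
def IsFSPair (μ : CMeasure) (a : ℝ → ℂ) : Prop :=
  μ.IsStronglyTempered ∧ LocSummable a ∧
    ∀ φ : ℝ → ℂ, ContDiff ℝ (⊤ : ℕ∞) φ → HasCompactSupport φ →
      μ.integral (FT φ) = ∑' lam : ℝ, a lam * φ lam

/-- Trigonometric polynomials. -/
def IsTrigPoly (f : ℂ → ℂ) : Prop :=
  ∃ (N : ℕ) (p : Fin N → ℂ) (θ : Fin N → ℝ),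
    ∀ z : ℂ, f z = ∑ n, p n * Complex.exp (2 * (Real.pi : ℂ) * Complex.I * (θ n : ℂ) * z)

/-- Functions of bounded type on the upper half-plane. -/
def BoundedType (g : ℂ → ℂ) : Prop :=
  ∃ P Q : ℂ → ℂ, DifferentiableOn ℂ P UHP ∧ DifferentiableOn ℂ Q UHP ∧
    (∃ C : ℝ, ∀ z ∈ UHP, ‖P z‖ ≤ C) ∧ (∃ C : ℝ, ∀ z ∈ UHP, ‖Q z‖ ≤ C) ∧
    (∀ z ∈ UHP, Q z ≠ 0) ∧ ∀ z ∈ UHP, g z = P z / Q z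

/-- Mean type `ϑ(g) = limsup_{y→∞} log|g(iy)|/y`. -/
def MeanType (g : ℂ → ℂ) : ℝ :=
  Filter.limsup (fun y : ℝ => Real.log ‖g ((y : ℂ) * Complex.I)‖ / y) atTop

/-- `E*(z) = conj (E (conj z))`. -/
def fstar (E : ℂ → ℂ) : ℂ → ℂ := fun z => (starRingEnd ℂ) (E ((starRingEnd ℂ) z))

/-- Hermite–Biehler class: entire with `|E*(z)| < |E(z)|` on the upper half-plane. -/
def HB (E : ℂ → ℂ) : Prop := Differentiable ℂ E ∧ ∀ z ∈ UHP, ‖fstar E z‖ < ‖E z‖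

/-- `A = (E* + E)/2`. -/
def HBA (E : ℂ → ℂ) : ℂ → ℂ := fun z => (fstar E z + E z) / 2

/-- `B = (E* - E)/(2i)`. -/
def HBB (E : ℂ → ℂ) : ℂ → ℂ := fun z => (fstar E z - E z) / (2 * Complex.I)

/-- `φ` is a phase function for `E`, with derivative `φd > 0`. -/
def IsPhaseFor (φ φd : ℝ → ℝ) (E : ℂ → ℂ) : Prop :=
  (∀ x : ℝ, HasDerivAt φ (φd x) x) ∧ (∀ x : ℝ, 0 < φd x) ∧
    ∀ x : ℝ, (Complex.exp (Complex.I * (φ x : ℂ)) * E (x : ℂ)).im = 0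

/-- The points where `φ ≡ 0 (mod π)`. -/
def phaseZeros (φ : ℝ → ℝ) : Set ℝ := {γ : ℝ | ∃ k : ℤ, φ γ = k * Real.pi}

/-- The nonnegative measure `2π Σ_{φ(γ)≡0 (mod π)} (1/φ'(γ)) δ_γ`. -/
def phaseMeasure (φ φd : ℝ → ℝ) : Measure ℝ :=
  Measure.sum fun γ : phaseZeros φ =>
    (ENNReal.ofReal (2 * Real.pi / φd (γ : ℝ))) • Measure.dirac (γ : ℝ)

/-- `μ` is an `ℕ`-valued nonnegative measure. -/
def CMeasure.NValued (μ : CMeasure) : Prop :=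
  μ.Nonneg ∧ ∃ (Λ : Set ℝ) (m : ℝ → ℕ), LocFinSet Λ ∧ (∀ γ ∈ Λ, 0 < m γ) ∧
    μ.ν = Measure.sum fun γ : Λ => (m (γ : ℝ) : ℝ≥0∞) • Measure.dirac (γ : ℝ)

/-- Bounded on every horizontal substrip of the upper half-plane. -/
def BddOnStrips (f : ℂ → ℂ) : Prop :=
  ∀ ε > (0:ℝ), ∃ C : ℝ, ∀ z : ℂ, ε < z.im → z.im < 1/ε → ‖f z‖ ≤ C

/-- The Fejér-type partial sums in formula (eq:fdef). -/
def fdefSum (a : ℝ → ℂ) (T : ℝ) (z : ℂ) : ℂ :=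
  a 0 / 2 + ∑' lam : ℝ,
    Set.indicator (Set.Ioo (0 : ℝ) T)
      (fun l => a l * (1 - (l : ℂ) / (T : ℂ)) *
        Complex.exp (2 * (Real.pi : ℂ) * Complex.I * (l : ℂ) * z)) lam

/-- A Harnack inequality for `log (M / ‖F‖)`, comparing the centre of a disc with another point. -/
theorem log_div_norm_center_le {F : ℂ → ℂ} {c w : ℂ} {R M : ℝ} (hM : 0 < M)
    (hd : DifferentiableOn ℂ F (Metric.ball c R)) (hnz : ∀ z ∈ Metric.ball c R, F z ≠ 0)
    (hb : ∀ z ∈ Metric.ball c R, ‖F z‖ ≤ M) (hw : w ∈ Metric.ball c R) :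
    (R - dist w c) * Real.log (M / ‖F c‖) ≤ (R + dist w c) * Real.log (M / ‖F w‖) := by
  have hR : 0 < R := lt_of_le_of_lt dist_nonneg hw
  have hc : c ∈ Metric.ball c R := Metric.mem_ball_self hR
  have hlog : ∀ z ∈ Metric.ball c R, 0 ≤ Real.log (M / ‖F z‖) := fun z hz =>
    Real.log_nonneg ((one_le_div (norm_pos_iff.2 (hnz z hz))).2 (hb z hz))
  obtain ⟨p, hpc, hp⟩ := (((hd.deriv Metric.isOpen_ball).div hd hnz).isExactOn_ball).with_val_at c 0
  set A := Real.log (M / ‖F c‖) with hA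
  have hdF : ∀ z ∈ Metric.ball c R, HasDerivAt F (deriv F z) z := fun z hz =>
    (hd.differentiableAt (Metric.isOpen_ball.mem_nhds hz)).hasDerivAt
  have hconst : ∀ z ∈ Metric.ball c R, F z * Complex.exp (-p z) = F c := by
    intro z hz
    have h1 : ∀ x ∈ Metric.ball c R,
        HasDerivAt (fun x => F x * Complex.exp (-p x)) 0 x := by
      intro x hx
      refine ((hdF x hx).mul ((hp x hx).neg.cexp)).congr_deriv ?_
      have := hnz x hx
      simp only [Pi.div_apply]
      field_simp
      ring
    have h2 := (convex_ball c R).is_const_of_fderivWithin_eq_zero (𝕜 := ℂ)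
      (f := fun x => F x * Complex.exp (-p x))
      (fun x hx => (h1 x hx).differentiableAt.differentiableWithinAt)
      (fun x hx => by
        rw [fderivWithin_of_isOpen Metric.isOpen_ball hx]
        simpa using (h1 x hx).hasFDerivAt.fderiv) hz hc
    simpa [hpc] using h2
  have hre : ∀ z ∈ Metric.ball c R, A - (p z).re = Real.log (M / ‖F z‖) := by
    intro z hz
    have h1 := congrArg norm (hconst z hz)
    rw [norm_mul, Complex.norm_exp] at h1
    have h2 := norm_pos_iff.2 (hnz z hz)
    rw [hA, ← h1, Real.log_div hM.ne' (by positivity), Real.log_mul h2.ne' (by positivity),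
      Real.log_exp, Real.log_div hM.ne' h2.ne']
    rw [neg_re]
    ring
  rcases (hlog c hc).eq_or_lt with h0 | hApos
  · rw [← hA] at h0
    rw [← h0, mul_zero]
    exact mul_nonneg (add_nonneg hR.le dist_nonneg) (hlog w hw)
  rw [← hA] at hApos
  have hq : ∀ z ∈ Metric.ball c R, 0 < ((A : ℂ) - p z + A).re := by
    intro z hz
    have := hlog z hz
    rw [← hre z hz] at this
    simp only [add_re, sub_re, ofReal_re]
    linarith
  have hq0 : ∀ z ∈ Metric.ball c R, (A : ℂ) - p z + A ≠ 0 := by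
    intro z hz h
    have := hq z hz
    rw [h] at this
    simp at this
  have hpd : DifferentiableOn ℂ p (Metric.ball c R) := fun z hz =>
    (hp z hz).differentiableAt.differentiableWithinAt
  have hmaps : MapsTo (fun z => -p z / ((A : ℂ) - p z + A)) (Metric.ball c R)
      (Metric.closedBall (-p c / ((A : ℂ) - p c + A)) 1) := by
    intro z hz
    have hpos := norm_pos_iff.2 (hq0 z hz)
    rw [hpc, mem_closedBall_iff_norm]
    simp only [neg_zero, zero_div, sub_zero, norm_div]
    rw [div_le_one hpos, norm_neg, ← sq_le_sq₀ (norm_nonneg _) (norm_nonneg _), ← normSq_eq_norm_sq,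
      ← normSq_eq_norm_sq, normSq_apply, normSq_apply]
    have := hlog z hz
    rw [← hre z hz] at this
    simp only [add_re, sub_re, ofReal_re, add_im, sub_im, ofReal_im]
    nlinarith
  have key := Complex.dist_le_div_mul_dist_of_mapsTo_ball
    (f := fun z => -p z / ((A : ℂ) - p z + A)) (hpd.neg.div (((differentiableOn_const _).sub hpd).add
      (differentiableOn_const _)) hq0) hmaps hw
  simp only [hpc, neg_zero, zero_div, dist_zero_right, norm_div, norm_neg] at key
  rw [div_le_iff₀ (norm_pos_iff.2 (hq0 w hw))] at key
  set ρ := 1 / R * dist w c with hρ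
  have hρ0 : 0 ≤ ρ := by positivity
  have hρ1 : ρ < 1 := by
    rw [hρ, one_div, inv_mul_lt_iff₀ hR, mul_one]; exact hw
  have key2 := pow_le_pow_left₀ (norm_nonneg _) key 2
  rw [mul_pow, ← normSq_eq_norm_sq, ← normSq_eq_norm_sq, normSq_apply, normSq_apply] at key2
  simp only [add_re, sub_re, ofReal_re, add_im, sub_im, ofReal_im] at key2
  have hre0 := hlog w hw
  rw [← hre w hw] at hre0 ⊢
  set u := (p w).re
  set v := (p w).im
  have hu : u ≤ ρ * (A - u + A) := by
    refine abs_le_of_sq_le_sq' ?_ (by nlinarith) |>.2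
    nlinarith [mul_nonneg (sub_nonneg.2 (pow_le_one₀ (n := 2) hρ0 hρ1.le)) (mul_self_nonneg v)]
  have hd' : dist w c = ρ * R := by rw [hρ]; field_simp
  rw [hd']
  nlinarith [mul_le_mul_of_nonneg_left hu hR.le]

/-- A function in `AP(ℍ)` is bounded on closed horizontal strips. -/
theorem APH.exists_norm_le {f : ℂ → ℂ} (hf : APH f) {α β : ℝ} (hα : 0 < α) (hαβ : α < β) :
    ∃ M > (0:ℝ), ∀ z : ℂ, α ≤ z.im → z.im ≤ β → ‖f z‖ ≤ M := by
  obtain ⟨τ, ⟨l, hl, hτ⟩, h⟩ := hf.2 (α / 2) (2 * β) 1 (by linarith) (by linarith) one_pos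
  have hK : IsCompact (Icc 0 l ×ℂ Icc α β) := isCompact_Icc.reProdIm isCompact_Icc
  obtain ⟨C, hC⟩ := hK.exists_bound_of_continuousOn (f := f) (hf.1.continuousOn.mono fun z hz =>
    lt_of_lt_of_le hα (mem_reProdIm.1 hz).2.1)
  refine ⟨|C| + 1, by positivity, fun z h1 h2 => ?_⟩
  obtain ⟨t, ht, h3, h4⟩ := hτ (-z.re)
  have h5 := h t ht z (by linarith) (by linarith)
  have h6 := hC (z + t) (by
    rw [mem_reProdIm]
    constructor <;> constructor <;> simp <;> linarith)
  have h7 := norm_sub_norm_le (f z) (f (z + t))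
  have h8 := le_abs_self C
  linarith

/-- A chain of Harnack inequalities along a segment inside a horizontal strip. -/
theorem log_div_norm_segment_le {f : ℂ → ℂ} {M α β : ℝ} (hα : 0 < α) (hαβ : α < β) (hM : 0 < M)
    (hd : DifferentiableOn ℂ f UHP) (hnz : ∀ z ∈ UHP, f z ≠ 0)
    (hb : ∀ z : ℂ, α / 2 ≤ z.im → z.im ≤ 2 * β → ‖f z‖ ≤ M) (n : ℕ) :
    ∀ w z : ℂ, α ≤ w.im → w.im ≤ β → α ≤ z.im → z.im ≤ β → ‖z - w‖ ≤ n * (α / 4) →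
      Real.log (M / ‖f z‖) ≤ 3 ^ n * Real.log (M / ‖f w‖) := by
  have hstep : ∀ w z : ℂ, α ≤ w.im → w.im ≤ β → α ≤ z.im → z.im ≤ β → ‖w - z‖ ≤ α / 4 →
      Real.log (M / ‖f z‖) ≤ 3 * Real.log (M / ‖f w‖) := by
    intro w z hw1 hw2 hz1 hz2 hwz
    have him : ∀ u ∈ Metric.ball z (α / 2), α / 2 ≤ u.im ∧ u.im ≤ 2 * β := by
      intro u hu
      rw [mem_ball_iff_norm] at hu
      have := abs_le.1 ((abs_im_le_norm (u - z)).trans hu.le)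
      simp only [sub_im] at this
      constructor <;> linarith
    have hsub : Metric.ball z (α / 2) ⊆ UHP := fun u hu =>
      lt_of_lt_of_le (half_pos hα) (him u hu).1
    have h1 := log_div_norm_center_le hM (hd.mono hsub) (fun u hu => hnz u (hsub hu))
      (fun u hu => hb u (him u hu).1 (him u hu).2) (w := w)
      (by rw [mem_ball_iff_norm]; linarith)
    rw [dist_eq_norm] at h1
    have h0 : 0 ≤ Real.log (M / ‖f w‖) := Real.log_nonneg
      ((one_le_div (norm_pos_iff.2 (hnz w (lt_of_lt_of_le hα hw1)))).2
        (hb w (by linarith) (by linarith)))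
    have h2 : (α / 2 - ‖w - z‖) * Real.log (M / ‖f z‖) ≤
        (α / 2 - ‖w - z‖) * (3 * Real.log (M / ‖f w‖)) := by
      nlinarith [norm_nonneg (w - z)]
    exact le_of_mul_le_mul_left h2 (by linarith)
  induction n with
  | zero =>
    intro w z _ _ _ _ h
    have : z = w := by simpa [sub_eq_zero] using h
    simp [this]
  | succ n ih =>
    intro w z hw1 hw2 hz1 hz2 h
    have hn : (0:ℝ) < n + 1 := by positivity
    set u : ℂ := w + ((n / (n + 1) : ℝ) : ℂ) * (z - w) with hu
    have hs0 : (0:ℝ) ≤ n / (n + 1) := by positivity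
    have hs1 : (n:ℝ) / (n + 1) ≤ 1 := by rw [div_le_one hn]; linarith
    have huim : u.im = w.im + n / (n + 1) * (z.im - w.im) := by
      rw [hu, add_im, im_ofReal_mul, sub_im]
    have hu1 : α ≤ u.im := by rw [huim]; nlinarith
    have hu2 : u.im ≤ β := by rw [huim]; nlinarith
    push_cast at h
    have h1 : ‖u - w‖ ≤ n * (α / 4) := by
      rw [hu, add_sub_cancel_left, norm_mul, norm_real, Real.norm_of_nonneg hs0,
        div_mul_eq_mul_div, div_le_iff₀ hn]
      nlinarith [Nat.cast_nonneg (α := ℝ) n]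
    have h2 : ‖u - z‖ ≤ α / 4 := by
      have : u - z = ((1 / (n + 1) : ℝ) : ℂ) * (w - z) := by
        rw [hu]
        have : ((n:ℂ) + 1) ≠ 0 := by exact_mod_cast hn.ne'
        push_cast
        field_simp
        ring
      rw [this, norm_mul, norm_real, Real.norm_of_nonneg (by positivity), norm_sub_rev,
        one_div, inv_mul_le_iff₀ hn]
      exact h
    have h3 := hstep u z hu1 hu2 hz1 hz2 h2
    have h4 := ih w u hw1 hw2 hu1 hu2 h1
    rw [pow_succ]
    linarith

/-- A nonvanishing function in `AP(ℍ)` is bounded away from zero on closed horizontal strips. -/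
theorem APH.exists_le_norm {f : ℂ → ℂ} (hf : APH f) (hnz : ∀ z ∈ UHP, f z ≠ 0) {α β : ℝ}
    (hα : 0 < α) (hαβ : α < β) :
    ∃ c > (0:ℝ), ∀ z : ℂ, α ≤ z.im → z.im ≤ β → c ≤ ‖f z‖ := by
  obtain ⟨M, hM, hb⟩ := hf.exists_norm_le (α := α / 2) (β := 2 * β) (by linarith) (by linarith)
  set v : ℂ := β * I with hv
  have hvim : v.im = β := by simp [hv]
  have hvre : v.re = 0 := by simp [hv]
  have hβ : 0 < β := hα.trans hαβ
  have hη : 0 < ‖f v‖ := norm_pos_iff.2 (hnz v (by change 0 < v.im; rw [hvim]; exact hβ))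
  obtain ⟨τ, ⟨l, hl, hτ⟩, h⟩ := hf.2 (α / 2) (2 * β) (‖f v‖ / 2) (by linarith) (by linarith)
    (by positivity)
  obtain ⟨n, hn⟩ := exists_nat_ge ((l + β) / (α / 4))
  rw [div_le_iff₀ (by positivity)] at hn
  refine ⟨M * Real.exp (-(3 ^ n * Real.log (M / (‖f v‖ / 2)))), by positivity, fun z h1 h2 => ?_⟩
  obtain ⟨t, ht, h3, h4⟩ := hτ z.re
  have h5 := h t ht v (by linarith) (by linarith)
  have h6 := norm_sub_norm_le (f v) (f (v + t))
  have h7 : ‖f v‖ / 2 ≤ ‖f (v + t)‖ := by linarith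
  have h8 : ‖z - (v + t)‖ ≤ n * (α / 4) := by
    refine (norm_le_abs_re_add_abs_im _).trans (le_trans (add_le_add ?_ ?_) hn)
    · rw [abs_le]; simp [hvre]; constructor <;> linarith
    · rw [abs_le]; simp [hvim]; constructor <;> linarith
  have h9 := log_div_norm_segment_le hα hαβ hM hf.1 hnz hb n (v + t) z (by simp [hvim, hαβ.le])
    (by simp [hvim]) h1 h2 h8
  have h10 : Real.log (M / ‖f (v + t)‖) ≤ Real.log (M / (‖f v‖ / 2)) :=
    Real.log_le_log (div_pos hM (lt_of_lt_of_le (by positivity) h7))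
      (div_le_div_of_nonneg_left hM.le (by positivity) h7)
  have h11 : Real.log (M / ‖f z‖) ≤ 3 ^ n * Real.log (M / (‖f v‖ / 2)) :=
    h9.trans (mul_le_mul_of_nonneg_left h10 (by positivity))
  have hz := norm_pos_iff.2 (hnz z (lt_of_lt_of_le hα h1))
  rw [Real.log_le_iff_le_exp (div_pos hM hz), div_le_iff₀ hz] at h11
  rw [Real.exp_neg, ← div_eq_mul_inv, div_le_iff₀ (Real.exp_pos _), mul_comm]
  exact h11

/-- The reciprocal of a nonvanishing function in `AP(ℍ)` is in `AP(ℍ)`. -/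
theorem APH.inv {f : ℂ → ℂ} (hf : APH f) (hnz : ∀ z ∈ UHP, f z ≠ 0) :
    APH (fun z => (f z)⁻¹) := by
  refine ⟨hf.1.inv hnz, fun α β ε hα hαβ hε => ?_⟩
  obtain ⟨c, hc, hb⟩ := hf.exists_le_norm hnz hα hαβ
  obtain ⟨τ, hτ, h⟩ := hf.2 α β (ε * (c * c)) hα hαβ (by positivity)
  refine ⟨τ, hτ, fun t ht z h1 h2 => ?_⟩
  have h3 := hb z h1.le h2.le
  have h4 := hb (z + t) (by simpa using h1.le) (by simpa using h2.le)
  have h5 := h t ht z h1 h2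
  rw [inv_sub_inv (norm_pos_iff.1 (hc.trans_le h3)) (norm_pos_iff.1 (hc.trans_le h4)), norm_div,
    norm_mul, norm_sub_rev, div_le_iff₀ (mul_pos (hc.trans_le h3) (hc.trans_le h4))]
  exact h5.trans (mul_le_mul_of_nonneg_left (mul_le_mul h3 h4 hc.le (norm_nonneg _)) hε.le)

/-- The truncated mean whose limit as `T → ∞` is the Fourier coefficient of `f` at `lam`. -/
def lineMean (f : ℂ → ℂ) (y lam T : ℝ) : ℂ :=
  (1 / (2 * (T : ℂ))) * ∫ x in (-T)..T, f ((x : ℂ) + (y : ℂ) * I) *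
    cexp (-(2 * (Real.pi : ℂ) * I * (lam : ℂ) * ((x : ℂ) + (y : ℂ) * I)))

theorem hasMeanAt_iff {f : ℂ → ℂ} {y lam : ℝ} {c : ℂ} :
    HasMeanAt f y lam c ↔ Tendsto (lineMean f y lam) atTop (𝓝 c) := Iff.rfl

theorem norm_cexp_two_pi_mul (lam : ℝ) (z : ℂ) :
    ‖cexp (2 * (Real.pi : ℂ) * I * (lam : ℂ) * z)‖ = Real.exp (-(2 * Real.pi * lam * z.im)) := by
  rw [norm_exp]
  congr 1
  simp [mul_re, mul_im]

theorem norm_cexp_neg_two_pi_mul (lam : ℝ) (z : ℂ) :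
    ‖cexp (-(2 * (Real.pi : ℂ) * I * (lam : ℂ) * z))‖ = Real.exp (2 * Real.pi * lam * z.im) := by
  rw [exp_neg, norm_inv, norm_cexp_two_pi_mul, Real.exp_neg, inv_inv]

theorem norm_lineMean_le {f : ℂ → ℂ} {y lam T C : ℝ} (hT : 0 < T)
    (h : ∀ x : ℝ, ‖f ((x : ℂ) + (y : ℂ) * I)‖ ≤ C) :
    ‖lineMean f y lam T‖ ≤ C * Real.exp (2 * Real.pi * lam * y) := by
  have h1 := intervalIntegral.norm_integral_le_of_norm_le_const (a := -T) (b := T)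
    (f := fun x : ℝ => f ((x : ℂ) + (y : ℂ) * I) *
      cexp (-(2 * (Real.pi : ℂ) * I * (lam : ℂ) * ((x : ℂ) + (y : ℂ) * I))))
    (C := C * Real.exp (2 * Real.pi * lam * y)) (fun x _ => by
      rw [norm_mul, norm_cexp_neg_two_pi_mul]
      simpa using mul_le_mul_of_nonneg_right (h x) (Real.exp_pos (2 * Real.pi * lam * y)).le)
  rw [lineMean, norm_mul, norm_div, norm_mul, norm_real, norm_one, Real.norm_of_nonneg hT.le,
    Complex.norm_two, one_div, inv_mul_le_iff₀ (by positivity)]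
  refine h1.trans_eq ?_
  rw [abs_of_pos (by linarith)]
  ring

theorem continuous_comp_line {f : ℂ → ℂ} (hf : ContinuousOn f UHP) {y : ℝ} (hy : 0 < y) :
    Continuous fun x : ℝ => f ((x : ℂ) + (y : ℂ) * I) :=
  hf.comp_continuous (by fun_prop) fun x => by
    change 0 < ((x : ℂ) + (y : ℂ) * I).im
    simpa using hy

theorem intervalIntegrable_lineMean {f : ℂ → ℂ} (hf : ContinuousOn f UHP) {y : ℝ} (hy : 0 < y)
    (lam a b : ℝ) : IntervalIntegrable (fun x : ℝ => f ((x : ℂ) + (y : ℂ) * I) *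
      cexp (-(2 * (Real.pi : ℂ) * I * (lam : ℂ) * ((x : ℂ) + (y : ℂ) * I)))) volume a b :=
  ((continuous_comp_line hf hy).mul (by fun_prop)).intervalIntegrable _ _

theorem lineMean_add {f g : ℂ → ℂ} (hf : ContinuousOn f UHP) (hg : ContinuousOn g UHP) {y : ℝ}
    (hy : 0 < y) (lam T : ℝ) :
    lineMean (fun z => f z + g z) y lam T = lineMean f y lam T + lineMean g y lam T := by
  simp only [lineMean, add_mul]
  rw [intervalIntegral.integral_add (intervalIntegrable_lineMean hf hy _ _ _)
    (intervalIntegrable_lineMean hg hy _ _ _), mul_add]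

theorem lineMean_const_mul (a : ℂ) (f : ℂ → ℂ) (y lam T : ℝ) :
    lineMean (fun z => a * f z) y lam T = a * lineMean f y lam T := by
  simp only [lineMean, mul_assoc]
  rw [intervalIntegral.integral_const_mul]
  ring

/-- The means at different heights have the same limiting behaviour, by Cauchy's theorem. -/
theorem tendsto_lineMean_sub {f : ℂ → ℂ} (hd : DifferentiableOn ℂ f UHP) {y₁ y₂ M : ℝ}
    (h₁ : 0 < y₁) (h₂ : 0 < y₂) (hb : ∀ z : ℂ, z.im ∈ uIcc y₁ y₂ → ‖f z‖ ≤ M) (lam : ℝ) :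
    Tendsto (fun T => lineMean f y₁ lam T - lineMean f y₂ lam T) atTop (𝓝 0) := by
  set G : ℂ → ℂ := fun z => f z * cexp (-(2 * (Real.pi : ℂ) * I * (lam : ℂ) * z)) with hG
  have hGd : DifferentiableOn ℂ G UHP := hd.mul (by fun_prop)
  set K : ℝ := M * Real.exp (2 * Real.pi * |lam| * max y₁ y₂) with hK
  have hpos : ∀ y ∈ uIcc y₁ y₂, 0 < y := fun y hy => lt_of_lt_of_le (lt_min h₁ h₂) hy.1
  have hGb : ∀ z : ℂ, z.im ∈ uIcc y₁ y₂ → ‖G z‖ ≤ K := by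
    intro z hz
    rw [hG, norm_mul, norm_cexp_neg_two_pi_mul]
    refine mul_le_mul (hb z hz) (Real.exp_le_exp.2 ?_) (Real.exp_pos _).le
      ((norm_nonneg _).trans (hb z hz))
    have h3 : z.im ≤ max y₁ y₂ := hz.2
    have h4 := hpos _ hz
    calc 2 * Real.pi * lam * z.im ≤ 2 * Real.pi * |lam| * z.im := by
          gcongr
          exact le_abs_self _
      _ ≤ _ := by gcongr
  refine squeeze_zero_norm' (a := fun T => K * |y₂ - y₁| * T⁻¹) ?_ ?_
  · filter_upwards [eventually_gt_atTop 0] with T hT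
    have hrect := Complex.integral_boundary_rect_eq_zero_of_differentiableOn G
      (((-T : ℝ) : ℂ) + (y₁ : ℂ) * I) ((T : ℂ) + (y₂ : ℂ) * I) (hGd.mono (by
        intro z hz
        have := (mem_reProdIm.1 hz).2
        simp only [add_im, ofReal_im, mul_I_im, ofReal_re, zero_add] at this
        exact hpos _ this))
    simp only [add_im, ofReal_im, mul_I_im, ofReal_re, zero_add, add_re, mul_I_re, neg_zero,
      add_zero] at hrect
    have hside : ∀ s : ℝ, ‖∫ y : ℝ in y₁..y₂, G ((s : ℂ) + (y : ℂ) * I)‖ ≤ K * |y₂ - y₁| :=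
      fun s => intervalIntegral.norm_integral_le_of_norm_le_const fun y hy =>
        hGb _ (by simpa using uIoc_subset_uIcc hy)
    have heq : lineMean f y₁ lam T - lineMean f y₂ lam T = (1 / (2 * (T : ℂ))) *
        (I • (∫ y : ℝ in y₁..y₂, G (((-T : ℝ) : ℂ) + (y : ℂ) * I)) -
          I • ∫ y : ℝ in y₁..y₂, G ((T : ℂ) + (y : ℂ) * I)) := by
      rw [lineMean, lineMean, ← mul_sub]
      congr 1
      linear_combination hrect
    rw [heq, norm_mul, norm_div, norm_mul, norm_real, norm_one, Real.norm_of_nonneg hT.le,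
      Complex.norm_two]
    have h5 := norm_sub_le (I • (∫ y : ℝ in y₁..y₂, G (((-T : ℝ) : ℂ) + (y : ℂ) * I)))
      (I • ∫ y : ℝ in y₁..y₂, G ((T : ℂ) + (y : ℂ) * I))
    rw [norm_smul, norm_smul, norm_I, one_mul, one_mul] at h5
    have h6 := h5.trans (add_le_add (hside (-T)) (hside T))
    rw [one_div, inv_mul_le_iff₀ (by positivity)]
    refine h6.trans_eq ?_
    field_simp
    ring
  · simpa using tendsto_inv_atTop_zero.const_mul (K * |y₂ - y₁|)

/-- The mean of an exponential. -/
theorem tendsto_lineMean_cexp (mu y lam : ℝ) :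
    Tendsto (lineMean (fun z => cexp (2 * (Real.pi : ℂ) * I * (mu : ℂ) * z)) y lam) atTop
      (𝓝 (if mu = lam then 1 else 0)) := by
  split_ifs with h
  · refine tendsto_const_nhds.congr' ?_
    filter_upwards [eventually_gt_atTop 0] with T hT
    have hT' : (T : ℂ) ≠ 0 := by exact_mod_cast hT.ne'
    subst h
    simp only [lineMean, ← exp_add, add_neg_cancel, exp_zero, intervalIntegral.integral_const]
    simp only [real_smul]
    push_cast
    field_simp
    norm_num
  · set c : ℂ := 2 * (Real.pi : ℂ) * I * ((mu : ℂ) - lam) with hc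
    have hc0 : c ≠ 0 := by
      rw [hc]
      have : (mu : ℂ) - lam ≠ 0 := by rw [sub_ne_zero]; exact_mod_cast h
      exact mul_ne_zero two_pi_I_ne_zero this
    have hnorm : ∀ x : ℝ, ‖cexp (c * x)‖ = 1 := by
      intro x
      have : c * x = ((2 * Real.pi * (mu - lam) * x : ℝ) : ℂ) * I := by
        rw [hc]; push_cast; ring
      rw [this, norm_exp_ofReal_mul_I]
    refine squeeze_zero_norm' (a := fun T => ‖cexp (c * (y * I))‖ / ‖c‖ * T⁻¹) ?_ ?_
    · filter_upwards [eventually_gt_atTop 0] with T hT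
      have : lineMean (fun z => cexp (2 * (Real.pi : ℂ) * I * (mu : ℂ) * z)) y lam T =
          (1 / (2 * (T : ℂ))) * (cexp (c * (y * I)) *
            ((cexp (c * (T : ℝ)) - cexp (c * (-T : ℝ))) / c)) := by
        rw [lineMean, ← integral_exp_mul_complex hc0,
          ← intervalIntegral.integral_const_mul (cexp (c * (y * I)))]
        congr 1
        apply intervalIntegral.integral_congr
        intro x _
        simp only
        rw [← exp_add, ← exp_add]
        congr 1
        rw [hc]
        ring
      rw [this, norm_mul, norm_div, norm_mul, norm_real, norm_one, Real.norm_of_nonneg hT.le,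
        Complex.norm_two, norm_mul, norm_div]
      have h1 := norm_sub_le (cexp (c * (T : ℝ))) (cexp (c * (-T : ℝ)))
      rw [hnorm, hnorm] at h1
      have hc1 := norm_pos_iff.2 hc0
      calc 1 / (2 * T) * (‖cexp (c * (y * I))‖ *
            (‖cexp (c * (T : ℝ)) - cexp (c * (-T : ℝ))‖ / ‖c‖))
          ≤ 1 / (2 * T) * (‖cexp (c * (y * I))‖ * ((1 + 1) / ‖c‖)) := by gcongr
        _ = _ := by field_simp; ring
    · simpa using tendsto_inv_atTop_zero.const_mul (‖cexp (c * (y * I))‖ / ‖c‖)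

/-- Evaluation of a trigonometric polynomial, encoded by its coefficients, at a point of `ℂ`. -/
def trigEval (z : ℂ) : AddMonoidAlgebra ℂ ℝ →ₐ[ℂ] ℂ :=
  AddMonoidAlgebra.lift ℂ ℂ ℝ
    { toFun := fun mu => cexp (2 * (Real.pi : ℂ) * I * ((mu.toAdd : ℝ) : ℂ) * z)
      map_one' := by simp
      map_mul' := fun a b => by
        rw [← exp_add, toAdd_mul]
        push_cast
        ring_nf }

theorem trigEval_single (z : ℂ) (mu : ℝ) (a : ℂ) :
    trigEval z (AddMonoidAlgebra.single mu a) =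
      a * cexp (2 * (Real.pi : ℂ) * I * (mu : ℂ) * z) := by
  simp [trigEval]

theorem differentiable_trigEval (Q : AddMonoidAlgebra ℂ ℝ) :
    Differentiable ℂ fun z => trigEval z Q := by
  induction Q using AddMonoidAlgebra.induction_linear with
  | zero => simp
  | add x y hx hy => simp only [map_add]; exact hx.fun_add hy
  | single m r => simp only [trigEval_single]; fun_prop

theorem tendsto_lineMean_trigEval (Q : AddMonoidAlgebra ℂ ℝ) {y : ℝ} (hy : 0 < y) (lam : ℝ) :
    Tendsto (lineMean (fun z => trigEval z Q) y lam) atTop (𝓝 (Q.coeff lam)) := by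
  induction Q using AddMonoidAlgebra.induction_linear with
  | zero =>
    have : lineMean (fun z => trigEval z 0) y lam = fun _ => 0 := by
      ext T; simp [lineMean]
    rw [this]
    simp
  | add P Q hP hQ =>
    have : lineMean (fun z => trigEval z (P + Q)) y lam = fun T =>
        lineMean (fun z => trigEval z P) y lam T + lineMean (fun z => trigEval z Q) y lam T := by
      ext T
      simp only [map_add]
      exact lineMean_add (differentiable_trigEval P).continuous.continuousOn
        (differentiable_trigEval Q).continuous.continuousOn hy lam T
    rw [this]
    simpa using hP.add hQ
  | single m r =>
    simp only [trigEval_single]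
    have h := (tendsto_lineMean_cexp m y lam).const_mul r
    have heq : (AddMonoidAlgebra.single m r).coeff lam = r * (if m = lam then 1 else 0) := by
      simp [Finsupp.single_apply]
    rw [heq]
    exact h.congr fun T => (lineMean_const_mul _ _ _ _ _).symm

/-- If `f` is asymptotic to a trigonometric polynomial with an error `O(e^{-2πBy})`, then below
`B` its spectrum is contained in the set of frequencies of that polynomial. -/
theorem specH_subset_of_norm_sub_trigEval_le {f : ℂ → ℂ} (hf : APH f) (Q : AddMonoidAlgebra ℂ ℝ)
    {B C Y : ℝ}
    (h : ∀ z : ℂ, Y ≤ z.im → ‖f z - trigEval z Q‖ ≤ C * Real.exp (-(2 * Real.pi * B * z.im)))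
    {lam : ℝ} (hlam : lam ∈ specH f) (hB : lam < B) : lam ∈ Q.coeff.support := by
  by_contra hQ
  rw [Finsupp.mem_support_iff, not_not] at hQ
  obtain ⟨y, hy, hy'⟩ := hlam
  apply hy'
  rw [hasMeanAt_iff, Metric.tendsto_nhds]
  intro ε hε
  have hdecay : Tendsto (fun y' : ℝ => C * Real.exp (-(2 * Real.pi * (B - lam)) * y')) atTop
      (𝓝 0) := by
    have : Tendsto (fun y' : ℝ => Real.exp (-(2 * Real.pi * (B - lam)) * y')) atTop (𝓝 0) :=
      Real.tendsto_exp_atBot.comp (tendsto_id.const_mul_atTop_of_neg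
        (by have := Real.pi_pos; nlinarith [sub_pos.2 hB]))
    simpa using this.const_mul C
  obtain ⟨y', hy'1, hy'2, hy'3⟩ := ((hdecay.eventually_lt_const (show 0 < ε / 3 by positivity)).and
    ((eventually_ge_atTop Y).and (eventually_gt_atTop 0))).exists
  obtain ⟨M, hM, hb⟩ := hf.exists_norm_le (α := min y y') (β := max y y' + 1) (lt_min hy hy'3)
    (by linarith [min_le_max (a := y) (b := y')])
  have h1 := tendsto_lineMean_sub hf.1 hy hy'3 (M := M)
    (fun z hz => hb z hz.1 (hz.2.trans (by linarith))) lam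
  have h2 := tendsto_lineMean_trigEval Q hy'3 lam
  rw [hQ] at h2
  filter_upwards [eventually_gt_atTop 0, (Metric.tendsto_nhds.1 h1) (ε / 3) (by positivity),
    (Metric.tendsto_nhds.1 h2) (ε / 3) (by positivity)] with T hT h3 h4
  rw [dist_zero_right] at h3 h4 ⊢
  have hPd := (differentiable_trigEval Q).continuous.continuousOn (s := UHP)
  have h5 : lineMean f y' lam T = lineMean (fun z => f z - trigEval z Q) y' lam T +
      lineMean (fun z => trigEval z Q) y' lam T := by
    have := lineMean_add (f := fun z => f z - trigEval z Q) (g := fun z => trigEval z Q)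
      (hf.1.continuousOn.sub hPd) hPd hy'3 lam T
    rw [← this]
    simp
  have h6 : ‖lineMean (fun z => f z - trigEval z Q) y' lam T‖ < ε / 3 := by
    refine lt_of_le_of_lt (norm_lineMean_le hT (C := C * Real.exp (-(2 * Real.pi * B * y')))
      fun x => ?_) (lt_of_eq_of_lt ?_ hy'1)
    · simpa using h ((x : ℂ) + (y' : ℂ) * I) (by simpa using hy'2)
    · rw [mul_assoc, ← Real.exp_add]
      ring_nf
  have h7 : lineMean f y lam T = (lineMean f y lam T - lineMean f y' lam T) +
      lineMean f y' lam T := by ring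
  rw [h7]
  refine (norm_add_le _ _).trans_lt ?_
  rw [h5] at h3 ⊢
  have h8 := norm_add_le (lineMean (fun z => f z - trigEval z Q) y' lam T)
    (lineMean (fun z => trigEval z Q) y' lam T)
  linarith

/-- If all Fourier integrals of `f` over `[0, 2T]` are at most `δ`, the autocorrelation of `f`
over `[0, T]` is small in mean square. -/
theorem integral_norm_sq_autocorrelation_le {f : ℝ → ℂ} (hf : Continuous f) {M : ℝ}
    (hM : ∀ x, ‖f x‖ ≤ M) {T δ : ℝ} (hT : 0 < T)
    (hδ : ∀ xi : ℝ, ‖∫ x in (0 : ℝ)..2 * T,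
      f x * cexp (-(2 * (Real.pi : ℂ) * I * (xi : ℂ) * (x : ℂ)))‖ ≤ δ) :
    ∫ x in (0 : ℝ)..T, ‖∫ t in (0 : ℝ)..T, f (x + t) * (starRingEnd ℂ) (f t)‖ ^ 2 ≤
      δ ^ 2 * ∫ t in (0 : ℝ)..T, ‖f t‖ ^ 2 := by
  have hM0 : 0 ≤ M := (norm_nonneg _).trans (hM 0)
  have hδ0 : 0 ≤ δ := (norm_nonneg _).trans (hδ 0)
  have hL : (0 : ℝ) < 2 * T := by positivity
  set F : ℝ → ℂ := fun x => f (2 * T * Int.fract (x / (2 * T))) with hF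
  have hFm : Measurable F := hf.measurable.comp
    (measurable_const.mul (measurable_fract.comp (measurable_id.div_const _)))
  have hFM : ∀ x, ‖F x‖ ≤ M := fun x => hM _
  have hFper : Function.Periodic F (2 * T) := by
    intro x
    simp only [hF]
    rw [add_div, div_self hL.ne', Int.fract_add_one]
  have hFeq : ∀ x ∈ Ico 0 (2 * T), F x = f x := by
    intro x hx
    simp only [hF]
    rw [Int.fract_eq_self.2 ⟨div_nonneg hx.1 hL.le, (div_lt_one hL).2 hx.2⟩,
      mul_div_cancel₀ _ hL.ne']
  set H : ℝ → ℂ := fun x => ∫ t in (0 : ℝ)..T, F (x + t) * (starRingEnd ℂ) (f t) with hH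
  have hjoint : Measurable fun p : ℝ × ℝ => F (p.1 + p.2) * (starRingEnd ℂ) (f p.2) :=
    (hFm.comp (measurable_fst.add measurable_snd)).mul
      (continuous_star.measurable.comp (hf.measurable.comp measurable_snd))
  have hHm : StronglyMeasurable H := by
    have h1 := StronglyMeasurable.integral_prod_right (ν := volume.restrict (Ioc 0 T))
      (f := fun x t => F (x + t) * (starRingEnd ℂ) (f t)) hjoint.stronglyMeasurable
    simpa only [hH, intervalIntegral.integral_of_le hT.le] using h1
  have hHM : ∀ x, ‖H x‖ ≤ M * M * T := by
    intro x
    refine (intervalIntegral.norm_integral_le_of_norm_le_const (C := M * M) fun t _ => ?_).trans_eq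
      (by rw [sub_zero, abs_of_pos hT])
    rw [norm_mul, RCLike.norm_conj]
    exact mul_le_mul (hFM _) (hM _) (norm_nonneg _) hM0
  set G : ℝ → ℂ := {x : ℝ | x ≤ T}.indicator f with hG
  have hmemT : T ∈ Icc 0 (2 * T) := ⟨hT.le, by linarith⟩
  have hGL : MemLp G 2 (volume.restrict (Ioc 0 (2 * T))) := by
    refine MemLp.of_bound (hf.measurable.indicator measurableSet_Iic).aestronglyMeasurable M
      (Eventually.of_forall fun x => ?_)
    exact (norm_indicator_le_norm_self _ _).trans (hM x)
  have hHL : MemLp H 2 (volume.restrict (Ioc 0 (2 * T))) :=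
    MemLp.of_bound hHm.aestronglyMeasurable _ (Eventually.of_forall hHM)
  set e : ℤ → ℝ → ℂ := fun n x => fourier (-n) (x : AddCircle (2 * T - 0)) with he
  have hexp : ∀ n x, e n x =
      cexp (-(2 * (Real.pi : ℂ) * I * ((n / (2 * T) : ℝ) : ℂ) * (x : ℂ))) := by
    intro n x
    simp only [he]
    rw [fourier_coe_apply]
    congr 1
    push_cast
    ring
  have heN : ∀ n x, ‖e n x‖ = 1 := by
    intro n x
    rw [hexp, norm_cexp_neg_two_pi_mul]
    simp
  have hec : ∀ n, Continuous (e n) := fun n => by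
    simp only [funext (hexp n)]
    fun_prop
  have headd : ∀ n x t, e n x = e n (x + t) * (starRingEnd ℂ) (e n t) := by
    intro n x t
    rw [hexp, hexp, hexp, ← exp_conj, ← exp_add]
    generalize (n / (2 * T) : ℝ) = q
    congr 1
    simp only [ofReal_add, map_neg, map_mul, conj_ofReal, conj_I, map_ofNat]
    ring
  have hcoefF : ∀ n, ‖∫ x in (0 : ℝ)..2 * T, e n x * F x‖ ≤ δ := by
    intro n
    refine le_of_eq_of_le ?_ (hδ (n / (2 * T)))
    congr 1
    rw [intervalIntegral.integral_of_le hL.le, intervalIntegral.integral_of_le hL.le,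
      integral_Ioc_eq_integral_Ioo, integral_Ioc_eq_integral_Ioo]
    refine setIntegral_congr_fun measurableSet_Ioo fun x hx => ?_
    rw [hFeq x ⟨hx.1.le, hx.2⟩, hexp, mul_comm]
  have hcoefH : ∀ n, ∫ x in (0 : ℝ)..2 * T, e n x * H x =
      (∫ x in (0 : ℝ)..2 * T, e n x * F x) *
        (starRingEnd ℂ) (∫ t in (0 : ℝ)..2 * T, e n t * G t) := by
    intro n
    have hGint : ∫ t in (0 : ℝ)..2 * T, e n t * G t = ∫ t in (0 : ℝ)..T, e n t * f t := by
      rw [← intervalIntegral.integral_indicator hmemT]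
      refine intervalIntegral.integral_congr fun x _ => ?_
      simp only [hG, indicator_apply]
      split_ifs <;> simp
    have hinner : ∀ t : ℝ, ∫ x in (0 : ℝ)..2 * T, e n x * (F (x + t) * (starRingEnd ℂ) (f t)) =
        (∫ x in (0 : ℝ)..2 * T, e n x * F x) * (starRingEnd ℂ) (e n t * f t) := by
      intro t
      have hper : Function.Periodic (fun x => e n x * F x) (2 * T) := by
        intro x
        simp only
        rw [hFper x]
        congr 1
        simp only [he]
        have := AddCircle.coe_add_period (2 * T - 0) x
        rw [sub_zero] at this ⊢
        rw [this]
      have h1 := hper.intervalIntegral_add_eq t 0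
      rw [zero_add] at h1
      rw [← h1, ← intervalIntegral.integral_mul_const, ← sub_zero t,
        show t - 0 + 2 * T = 2 * T + t by ring, sub_zero]
      have h2 := intervalIntegral.integral_comp_add_right (a := 0) (b := 2 * T)
        (fun x => e n x * F x * (starRingEnd ℂ) (e n t * f t)) t
      rw [zero_add] at h2
      rw [← h2]
      refine intervalIntegral.integral_congr fun x _ => ?_
      rw [headd n x t, map_mul]
      ring
    rw [hGint]
    simp only [hH, ← intervalIntegral.integral_const_mul]
    simp only [intervalIntegral.integral_of_le hT.le]
    rw [intervalIntegral_integral_swap]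
    · simp only [hinner]
      rw [integral_const_mul, integral_conj]
    · have : IsFiniteMeasure ((volume.restrict (uIoc 0 (2 * T))).prod
          (volume.restrict (Ioc (0 : ℝ) T))) := by
        rw [uIoc_of_le hL.le]
        infer_instance
      refine Integrable.of_bound (C := M * M) ?_ (Eventually.of_forall fun p => ?_)
      · exact (((hec n).measurable.comp measurable_fst).mul hjoint).aestronglyMeasurable
      · simp only [Function.uncurry, norm_mul, heN, one_mul, RCLike.norm_conj]
        exact mul_le_mul (hFM _) (hM _) (norm_nonneg _) hM0
  have hsumH := hasSum_sq_fourierCoeffOn hL hHL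
  have hsumG := (hasSum_sq_fourierCoeffOn hL hGL).mul_left (δ ^ 2)
  have hle := hasSum_le (fun n => ?_) hsumH hsumG
  · have h3 : ∫ x in (0 : ℝ)..2 * T, ‖G x‖ ^ 2 = ∫ t in (0 : ℝ)..T, ‖f t‖ ^ 2 := by
      rw [← intervalIntegral.integral_indicator hmemT]
      refine intervalIntegral.integral_congr fun x _ => ?_
      simp only [hG, indicator_apply]
      split_ifs <;> simp
    have hHi : ∀ a b : ℝ, IntervalIntegrable (fun x => ‖H x‖ ^ 2) volume a b := by
      intro a b
      refine (intervalIntegrable_const (c := (M * M * T) ^ 2)).mono_fun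
        (hHm.norm.pow 2).aestronglyMeasurable (Eventually.of_forall fun x => ?_)
      simp only [norm_pow, norm_norm]
      gcongr
      exact (hHM x).trans (le_abs_self _)
    have h4 : ∫ x in (0 : ℝ)..T, ‖∫ t in (0 : ℝ)..T, f (x + t) * (starRingEnd ℂ) (f t)‖ ^ 2 =
        ∫ x in (0 : ℝ)..T, ‖H x‖ ^ 2 := by
      rw [intervalIntegral.integral_of_le hT.le, intervalIntegral.integral_of_le hT.le,
        integral_Ioc_eq_integral_Ioo, integral_Ioc_eq_integral_Ioo]
      refine setIntegral_congr_fun measurableSet_Ioo fun x hx => ?_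
      simp only [hH]
      congr 2
      refine intervalIntegral.integral_congr fun t ht => ?_
      rw [uIcc_of_le hT.le] at ht
      rw [hFeq _ ⟨by linarith [hx.1, ht.1], by linarith [hx.2, ht.2]⟩]
    have h5 : ∫ x in (0 : ℝ)..T, ‖H x‖ ^ 2 ≤ ∫ x in (0 : ℝ)..2 * T, ‖H x‖ ^ 2 := by
      rw [← intervalIntegral.integral_add_adjacent_intervals (hHi 0 T) (hHi T (2 * T))]
      have := intervalIntegral.integral_nonneg (a := T) (b := 2 * T) (μ := volume)
        (f := fun x => ‖H x‖ ^ 2) (by linarith) (fun x _ => by positivity)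
      linarith
    rw [h4]
    refine h5.trans ?_
    rw [h3, smul_eq_mul, smul_eq_mul, sub_zero, mul_left_comm] at hle
    exact le_of_mul_le_mul_left hle (by positivity)
  · rw [← mul_pow]
    gcongr
    rw [fourierCoeffOn_eq_integral, fourierCoeffOn_eq_integral, norm_smul, norm_smul]
    simp only [smul_eq_mul]
    change _ * ‖∫ x in (0 : ℝ)..2 * T, e n x * H x‖ ≤
      δ * (_ * ‖∫ x in (0 : ℝ)..2 * T, e n x * G x‖)
    rw [hcoefH, norm_mul, RCLike.norm_conj, mul_left_comm δ]
    gcongr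
    exact hcoefF n

/-- The character `x ↦ e^{-2πiξx}` of the real line. -/
def waveR (xi x : ℝ) : ℂ := cexp (-(2 * (Real.pi : ℂ) * I * (xi : ℂ) * (x : ℂ)))

theorem norm_waveR (xi x : ℝ) : ‖waveR xi x‖ = 1 := by
  rw [waveR, norm_cexp_neg_two_pi_mul]
  simp

theorem continuous_waveR (xi : ℝ) : Continuous (waveR xi) := by
  unfold waveR
  fun_prop

theorem waveR_add (xi x y : ℝ) : waveR xi (x + y) = waveR xi x * waveR xi y := by
  rw [waveR, waveR, waveR, ← exp_add]
  push_cast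
  ring_nf

theorem waveR_add_left (xi eta x : ℝ) : waveR (xi + eta) x = waveR xi x * waveR eta x := by
  rw [waveR, waveR, waveR, ← exp_add]
  push_cast
  ring_nf

theorem norm_waveR_sub_one_le (xi x : ℝ) : ‖waveR xi x - 1‖ ≤ 2 * Real.pi * |xi| * |x| := by
  have h := Real.norm_exp_I_mul_ofReal_sub_one_le (x := -(2 * Real.pi * xi * x))
  have h1 : waveR xi x = cexp (I * ((-(2 * Real.pi * xi * x) : ℝ) : ℂ)) := by
    rw [waveR]
    push_cast
    ring_nf
  rw [h1]
  refine h.trans_eq ?_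
  rw [norm_neg, Real.norm_eq_abs, abs_mul, abs_mul, abs_of_pos Real.two_pi_pos]

theorem APR.exists_norm_le {f : ℝ → ℂ} (hf : APR f) : ∃ M > 0, ∀ x, ‖f x‖ ≤ M := by
  obtain ⟨l, hl, h⟩ := hf.2 1 one_pos
  obtain ⟨C, hC⟩ := isCompact_Icc.exists_bound_of_continuousOn (s := Icc 0 l)
    (hf.1.continuousOn)
  refine ⟨|C| + 1, by positivity, fun x => ?_⟩
  obtain ⟨t, ht, h1, h2⟩ := h (-x)
  have h3 := ht x
  have h4 := hC (x + t) ⟨by linarith, by linarith⟩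
  have h5 := norm_sub_norm_le (f x) (f (x + t))
  linarith [le_abs_self C]

theorem APR.exists_norm_sub_le {f : ℝ → ℂ} (hf : APR f) {ε : ℝ} (hε : 0 < ε) :
    ∃ δ > 0, ∀ x h : ℝ, |h| ≤ δ → ‖f (x + h) - f x‖ ≤ ε := by
  obtain ⟨l, hl, h⟩ := hf.2 (ε / 3) (by positivity)
  have huc := isCompact_Icc.uniformContinuousOn_of_continuous (s := Icc (-1) (l + 1))
    (hf.1.continuousOn)
  obtain ⟨δ, hδ, hd⟩ := Metric.uniformContinuousOn_iff.1 huc (ε / 3) (by positivity)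
  refine ⟨min 1 (δ / 2), by positivity, fun x s hs => ?_⟩
  obtain ⟨t, ht, h1, h2⟩ := h (-x)
  have hs1 := abs_le.1 (hs.trans (min_le_left _ _))
  have hs2 := hs.trans (min_le_right _ _)
  have h3 := ht x
  have h4 := ht (x + s)
  have h5 := (hd (x + s + t) ⟨by linarith, by linarith⟩ (x + t) ⟨by linarith, by linarith⟩ (by
    rw [Real.dist_eq, show x + s + t - (x + t) = s by ring]
    linarith)).le
  rw [dist_eq_norm] at h5
  have h6 : f (x + s) - f x = (f (x + s) - f (x + s + t)) + (f (x + s + t) - f (x + t)) -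
      (f x - f (x + t)) := by ring
  rw [h6]
  have h7 := norm_sub_le ((f (x + s) - f (x + s + t)) + (f (x + s + t) - f (x + t)))
    (f x - f (x + t))
  have h8 := norm_add_le (f (x + s) - f (x + s + t)) (f (x + s + t) - f (x + t))
  linarith

theorem norm_integral_shift_sub_le {g : ℝ → ℂ} (hg : Continuous g) {M : ℝ}
    (hM : ∀ x, ‖g x‖ ≤ M) (a b h : ℝ) :
    ‖(∫ x in (a + h)..(b + h), g x) - ∫ x in a..b, g x‖ ≤ 2 * M * |h| := by
  have h1 : (∫ x in (a + h)..(b + h), g x) - ∫ x in a..b, g x =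
      (∫ x in b..(b + h), g x) - ∫ x in a..(a + h), g x := by
    rw [intervalIntegral.integral_interval_sub_interval_comm (hg.intervalIntegrable _ _)
      (hg.intervalIntegrable _ _) (hg.intervalIntegrable _ _), intervalIntegral.integral_symm a,
      intervalIntegral.integral_symm b]
    ring
  have h2 : ∀ c, ‖∫ x in c..(c + h), g x‖ ≤ M * |h| := fun c => by
    have := intervalIntegral.norm_integral_le_of_norm_le_const (a := c) (b := c + h)
      (fun x _ => hM x)
    simpa using this
  rw [h1]
  refine (norm_sub_le _ _).trans ?_
  linarith [h2 a, h2 b]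

/-- If the means of an almost periodic function at a frequency come close to zero, the integrals
over all windows of a suitable length are uniformly small. -/
theorem APR.exists_window {f : ℝ → ℂ} (hf : APR f) {xi : ℝ}
    (h0 : ∀ ε > 0, ∃ᶠ T : ℝ in atTop, ‖∫ x in (-T)..T, f x * waveR xi x‖ ≤ ε * T)
    {ε : ℝ} (hε : 0 < ε) :
    ∃ L > 0, ∀ a : ℝ, ‖∫ x in a..(a + L), f x * waveR xi x‖ ≤ ε * L := by
  obtain ⟨M, hM, hb⟩ := hf.exists_norm_le
  obtain ⟨l, hl, h⟩ := hf.2 (ε / 4) (by positivity)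
  obtain ⟨T, hT, hT1, hT2⟩ := ((h0 (ε / 2) (by positivity)).and_eventually
    ((eventually_gt_atTop 0).and (eventually_ge_atTop (2 * M * l / ε)))).exists
  refine ⟨2 * T, by positivity, fun a => ?_⟩
  obtain ⟨t, ht, h1, h2⟩ := h (a + T)
  have hc : Continuous fun x => f x * waveR xi x := hf.1.mul (continuous_waveR xi)
  have hcM : ∀ x, ‖f x * waveR xi x‖ ≤ M := fun x => by
    rw [norm_mul, norm_waveR, mul_one]; exact hb x
  have h3 := norm_integral_shift_sub_le hc hcM (-T + t) (T + t) (a + T - t)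
  rw [show -T + t + (a + T - t) = a by ring, show T + t + (a + T - t) = a + 2 * T by ring] at h3
  have h4 : ∫ x in (-T + t)..(T + t), f x * waveR xi x =
      waveR xi t * ∫ x in (-T)..T, f (x + t) * waveR xi x := by
    rw [← intervalIntegral.integral_comp_add_right, ← intervalIntegral.integral_const_mul]
    refine intervalIntegral.integral_congr fun x _ => ?_
    simp only [waveR_add]
    ring
  have h5 : ‖(∫ x in (-T)..T, f x * waveR xi x) - ∫ x in (-T)..T, f (x + t) * waveR xi x‖ ≤
      ε / 4 * (2 * T) := by
    have hc2 : Continuous fun x => f (x + t) * waveR xi x :=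
      (hf.1.comp (continuous_add_const t)).mul (continuous_waveR xi)
    rw [← intervalIntegral.integral_sub (hc.intervalIntegrable _ _) (hc2.intervalIntegrable _ _)]
    have := intervalIntegral.norm_integral_le_of_norm_le_const (a := -T) (b := T) (C := ε / 4)
      (f := fun x => f x * waveR xi x - f (x + t) * waveR xi x) (fun x _ => by
        rw [← sub_mul, norm_mul, norm_waveR, mul_one]
        exact ht x)
    rwa [show T - -T = 2 * T by ring, abs_of_pos (by positivity)] at this
  have h6 : ‖∫ x in (-T + t)..(T + t), f x * waveR xi x‖ ≤ ε * T := by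
    rw [h4, norm_mul, norm_waveR, one_mul]
    have := norm_sub_norm_le (∫ x in (-T)..T, f (x + t) * waveR xi x)
      (∫ x in (-T)..T, f x * waveR xi x)
    rw [norm_sub_rev] at this
    linarith
  have h7 : |a + T - t| ≤ l := abs_le.2 ⟨by linarith, by linarith⟩
  have h8 : 2 * M * l ≤ T * ε := (div_le_iff₀ hε).1 hT2
  have h9 : 2 * M * |a + T - t| ≤ 2 * M * l := by gcongr
  have h10 := norm_sub_norm_le (∫ x in a..(a + 2 * T), f x * waveR xi x)
    (∫ x in (-T + t)..(T + t), f x * waveR xi x)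
  linarith

theorem norm_integral_le_of_window {g : ℝ → ℂ} (hg : Continuous g) {M L c : ℝ}
    (hM : ∀ x, ‖g x‖ ≤ M) (hL : 0 < L) (hc : ∀ a : ℝ, ‖∫ x in a..(a + L), g x‖ ≤ c * L) {T : ℝ}
    (hT : 0 ≤ T) : ‖∫ x in (0 : ℝ)..T, g x‖ ≤ c * T + M * L := by
  have hM0 : 0 ≤ M := (norm_nonneg _).trans (hM 0)
  have hc0 : 0 ≤ c := by
    have := (norm_nonneg _).trans (hc 0)
    exact nonneg_of_mul_nonneg_left this hL
  have hn : ∀ n : ℕ, ‖∫ x in (0 : ℝ)..(n * L), g x‖ ≤ n * (c * L) := by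
    intro n
    induction n with
    | zero => simp
    | succ n ih =>
      rw [← intervalIntegral.integral_add_adjacent_intervals (b := (n * L : ℝ))
        (hg.intervalIntegrable _ _) (hg.intervalIntegrable _ _)]
      refine (norm_add_le _ _).trans ?_
      have := hc (n * L)
      push_cast
      rw [show ((n : ℝ) + 1) * L = n * L + L by ring]
      linarith
  have h1 := hn ⌊T / L⌋₊
  have h2 := Nat.floor_le (div_nonneg hT hL.le)
  have h3 := Nat.lt_floor_add_one (T / L)
  rw [le_div_iff₀ hL] at h2
  rw [div_lt_iff₀ hL] at h3
  rw [← intervalIntegral.integral_add_adjacent_intervals (b := (⌊T / L⌋₊ * L : ℝ))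
    (hg.intervalIntegrable _ _) (hg.intervalIntegrable _ _)]
  refine (norm_add_le _ _).trans ?_
  have h4 := intervalIntegral.norm_integral_le_of_norm_le_const (a := (⌊T / L⌋₊ * L : ℝ)) (b := T)
    (fun x _ => hM x)
  rw [abs_of_nonneg (by linarith)] at h4
  have h5 : M * (T - ⌊T / L⌋₊ * L) ≤ M * L := by gcongr; linarith
  have h6 : c * (⌊T / L⌋₊ * L) ≤ c * T := by gcongr
  linarith

theorem APR.exists_high_frequency {f : ℝ → ℂ} (hf : APR f) {ε : ℝ} (hε : 0 < ε) :
    ∃ Xi > 0, ∃ T₀ > 0, ∀ xi : ℝ, Xi ≤ |xi| → ∀ T ≥ T₀,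
      ‖∫ x in (0 : ℝ)..T, f x * waveR xi x‖ ≤ ε * T := by
  obtain ⟨M, hM, hb⟩ := hf.exists_norm_le
  obtain ⟨δ, hδ, hd⟩ := hf.exists_norm_sub_le hε
  refine ⟨1 / (2 * δ), by positivity, 2 * M * δ / ε, by positivity, fun xi hxi T hT => ?_⟩
  have hT0 : 0 < T := lt_of_lt_of_le (by positivity) hT
  have hxi0 : 0 < |xi| := lt_of_lt_of_le (by positivity) hxi
  have hxi1 : xi ≠ 0 := abs_pos.1 hxi0
  set h : ℝ := 1 / (2 * xi) with hh
  have hhd : |h| ≤ δ := by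
    rw [hh, abs_div, abs_mul, abs_one, abs_two, div_le_iff₀ (by positivity)]
    rw [div_le_iff₀ (by positivity)] at hxi
    linarith
  have hw : waveR xi h = -1 := by
    have hxc : (xi : ℂ) ≠ 0 := by exact_mod_cast hxi1
    rw [waveR, ← exp_neg_pi_mul_I]
    congr 1
    rw [hh]
    push_cast
    field_simp
  have hc : Continuous fun x => f x * waveR xi x := hf.1.mul (continuous_waveR xi)
  have hcM : ∀ x, ‖f x * waveR xi x‖ ≤ M := fun x => by
    rw [norm_mul, norm_waveR, mul_one]; exact hb x
  have h3 := norm_integral_shift_sub_le hc hcM 0 T h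
  have h4 : ∫ x in (0 + h)..(T + h), f x * waveR xi x =
      -∫ x in (0 : ℝ)..T, f (x + h) * waveR xi x := by
    rw [← intervalIntegral.integral_comp_add_right, ← intervalIntegral.integral_neg]
    refine intervalIntegral.integral_congr fun x _ => ?_
    simp only [waveR_add, hw]
    ring
  have h5 : ‖(∫ x in (0 : ℝ)..T, f (x + h) * waveR xi x) - ∫ x in (0 : ℝ)..T, f x * waveR xi x‖ ≤
      ε * T := by
    have hc2 : Continuous fun x => f (x + h) * waveR xi x :=
      (hf.1.comp (continuous_add_const h)).mul (continuous_waveR xi)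
    rw [← intervalIntegral.integral_sub (hc2.intervalIntegrable _ _) (hc.intervalIntegrable _ _)]
    have := intervalIntegral.norm_integral_le_of_norm_le_const (a := 0) (b := T) (C := ε)
      (f := fun x => f (x + h) * waveR xi x - f x * waveR xi x) (fun x _ => by
        rw [← sub_mul, norm_mul, norm_waveR, mul_one]
        exact hd x h hhd)
    rwa [sub_zero, abs_of_pos hT0] at this
  have h6 : (2 : ℂ) * ∫ x in (0 : ℝ)..T, f x * waveR xi x =
      -((∫ x in (0 : ℝ)..T, f (x + h) * waveR xi x) - ∫ x in (0 : ℝ)..T, f x * waveR xi x) -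
      ((∫ x in (0 + h)..(T + h), f x * waveR xi x) - ∫ x in (0 : ℝ)..T, f x * waveR xi x) := by
    rw [h4]
    ring
  have h7 := congrArg norm h6
  rw [norm_mul, Complex.norm_two] at h7
  have h8 := norm_sub_le
    (-((∫ x in (0 : ℝ)..T, f (x + h) * waveR xi x) - ∫ x in (0 : ℝ)..T, f x * waveR xi x))
    ((∫ x in (0 + h)..(T + h), f x * waveR xi x) - ∫ x in (0 : ℝ)..T, f x * waveR xi x)
  rw [← h7, norm_neg] at h8
  have h9 : 2 * M * δ ≤ T * ε := (div_le_iff₀ hε).1 hT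
  have h10 : 2 * M * |h| ≤ 2 * M * δ := by gcongr
  linarith

/-- Vanishing of the means at all frequencies is uniform in the frequency. -/
theorem APR.exists_uniform {f : ℝ → ℂ} (hf : APR f)
    (h0 : ∀ xi : ℝ, ∀ ε > 0, ∃ᶠ T : ℝ in atTop, ‖∫ x in (-T)..T, f x * waveR xi x‖ ≤ ε * T)
    {ε : ℝ} (hε : 0 < ε) :
    ∃ T₀ > 0, ∀ xi : ℝ, ∀ T ≥ T₀, ‖∫ x in (0 : ℝ)..T, f x * waveR xi x‖ ≤ ε * T := by
  obtain ⟨M, hM, hb⟩ := hf.exists_norm_le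
  obtain ⟨Xi, hXi, T₁, hT₁, hhigh⟩ := hf.exists_high_frequency hε
  have hlow : ∃ T₀ > 0, ∀ xi ∈ Icc (-Xi) Xi, ∀ T ≥ T₀,
      ‖∫ x in (0 : ℝ)..T, f x * waveR xi x‖ ≤ ε * T := by
    refine isCompact_Icc.induction_on (s := Icc (-Xi) Xi)
      (p := fun s => ∃ T₀ > 0, ∀ xi ∈ s, ∀ T ≥ T₀,
        ‖∫ x in (0 : ℝ)..T, f x * waveR xi x‖ ≤ ε * T) ⟨1, one_pos, by simp⟩ ?_ ?_ ?_
    · rintro s t hst ⟨T₀, hT₀, h⟩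
      exact ⟨T₀, hT₀, fun xi hxi => h xi (hst hxi)⟩
    · rintro s t ⟨T₀, hT₀, h⟩ ⟨T₂, hT₂, h'⟩
      refine ⟨max T₀ T₂, lt_max_of_lt_left hT₀, fun xi hxi T hT => ?_⟩
      rcases hxi with hxi | hxi
      · exact h xi hxi T ((le_max_left _ _).trans hT)
      · exact h' xi hxi T ((le_max_right _ _).trans hT)
    · intro xi₀ _
      obtain ⟨L, hL, hw⟩ := hf.exists_window (h0 xi₀) (ε := ε / 3) (by positivity)
      set ρ : ℝ := ε / 3 / (2 * Real.pi * L * M) with hρ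
      have hπ := Real.pi_pos
      have hρ0 : 0 < ρ := by positivity
      refine ⟨Metric.ball xi₀ ρ, mem_nhdsWithin_of_mem_nhds (Metric.ball_mem_nhds _ hρ0),
        3 * M * L / ε, by positivity, fun xi hxi T hT => ?_⟩
      have hT0 : 0 < T := lt_of_lt_of_le (by positivity) hT
      rw [Metric.mem_ball, Real.dist_eq] at hxi
      have hc : ∀ xi, Continuous fun x => f x * waveR xi x :=
        fun xi => hf.1.mul (continuous_waveR xi)
      have hcM : ∀ x, ‖f x * waveR xi x‖ ≤ M := fun x => by
        rw [norm_mul, norm_waveR, mul_one]; exact hb x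
      have hwin : ∀ a : ℝ, ‖∫ x in a..(a + L), f x * waveR xi x‖ ≤ 2 * ε / 3 * L := by
        intro a
        have hcw : Continuous fun x => f x * waveR xi₀ x * (waveR (xi - xi₀) (x - a) - 1) :=
          (hc _).mul (((continuous_waveR _).comp (continuous_sub_right a)).sub continuous_const)
        have h1 : ∫ x in a..(a + L), f x * waveR xi x =
            waveR (xi - xi₀) a * ((∫ x in a..(a + L), f x * waveR xi₀ x) +
              ∫ x in a..(a + L), f x * waveR xi₀ x * (waveR (xi - xi₀) (x - a) - 1)) := by
          rw [← intervalIntegral.integral_add ((hc _).intervalIntegrable _ _)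
            (hcw.intervalIntegrable _ _),
            ← intervalIntegral.integral_const_mul]
          refine intervalIntegral.integral_congr fun x _ => ?_
          have h2 : waveR xi x = waveR xi₀ x * (waveR (xi - xi₀) (x - a) * waveR (xi - xi₀) a) := by
            rw [← waveR_add, sub_add_cancel, ← waveR_add_left, add_sub_cancel]
          simp only [h2]
          ring
        rw [h1, norm_mul, norm_waveR, one_mul]
        refine (norm_add_le _ _).trans ?_
        have h2 := intervalIntegral.norm_integral_le_of_norm_le_const (a := a) (b := a + L)
          (C := ε / 3)
          (f := fun x => f x * waveR xi₀ x * (waveR (xi - xi₀) (x - a) - 1)) (fun x hx => by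
            rw [uIoc_of_le (by linarith)] at hx
            rw [norm_mul, norm_mul, norm_waveR, mul_one]
            calc ‖f x‖ * ‖waveR (xi - xi₀) (x - a) - 1‖
                ≤ M * (2 * Real.pi * |xi - xi₀| * |x - a|) :=
                  mul_le_mul (hb x) (norm_waveR_sub_one_le _ _) (norm_nonneg _) hM.le
              _ ≤ M * (2 * Real.pi * ρ * L) := by
                  gcongr
                  rw [abs_of_pos (by linarith [hx.1])]
                  linarith [hx.2]
              _ = ε / 3 := by rw [hρ]; field_simp)
        rw [show a + L - a = L by ring, abs_of_pos hL] at h2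
        have h3 := hw a
        linarith
      have h4 := norm_integral_le_of_window (hc xi) hcM hL hwin hT0.le
      have h5 : 3 * M * L ≤ T * ε := (div_le_iff₀ hε).1 hT
      linarith
  obtain ⟨T₂, hT₂, hlow⟩ := hlow
  refine ⟨max T₁ T₂, lt_max_of_lt_left hT₁, fun xi T hT => ?_⟩
  rcases le_total Xi |xi| with h | h
  · exact hhigh xi h T ((le_max_left _ _).trans hT)
  · exact hlow xi (abs_le.1 h) T ((le_max_right _ _).trans hT)

theorem le_integral_of_relDense {g : ℝ → ℝ} (hg : Continuous g) (hg0 : ∀ x, 0 ≤ g x)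
    {τ : Set ℝ} {l δ v L : ℝ} (hδ : 0 ≤ δ) (hτ : ∀ x : ℝ, ∃ t ∈ τ, x < t ∧ t < x + l)
    (hv : ∀ t ∈ τ, ∀ s : ℝ, |s| ≤ δ → v ≤ g (t + s)) (hL : l + 2 * δ ≤ L) (n : ℕ) :
    n * (2 * δ * v) ≤ ∫ x in (0 : ℝ)..(n * L), g x := by
  induction n with
  | zero => simp
  | succ n ih =>
    obtain ⟨t, ht, h1, h2⟩ := hτ (n * L + δ)
    have hi : ∀ a b, IntervalIntegrable g volume a b := fun a b => hg.intervalIntegrable _ _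
    have h3 : 2 * δ * v ≤ ∫ x in (t - δ)..(t + δ), g x := by
      have := intervalIntegral.integral_mono_on (a := t - δ) (b := t + δ) (by linarith)
        (intervalIntegrable_const (c := v)) (hi _ _) (fun x hx => by
          have := hv t ht (x - t) (abs_le.2 ⟨by linarith [hx.1], by linarith [hx.2]⟩)
          rwa [add_sub_cancel] at this)
      rw [intervalIntegral.integral_const, smul_eq_mul] at this
      refine le_trans (le_of_eq ?_) this
      ring
    have h4 := intervalIntegral.integral_add_adjacent_intervals (hi 0 (n * L)) (hi _ (t - δ))
    have h5 := intervalIntegral.integral_add_adjacent_intervals (hi 0 (t - δ)) (hi _ (t + δ))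
    have h6 := intervalIntegral.integral_add_adjacent_intervals (hi 0 (t + δ))
      (hi _ (((n + 1 : ℕ) : ℝ) * L))
    have h7 := intervalIntegral.integral_nonneg (a := n * L) (b := t - δ) (μ := volume) (f := g)
      (by linarith) (fun x _ => hg0 x)
    have h8 := intervalIntegral.integral_nonneg (a := t + δ) (b := ((n + 1 : ℕ) : ℝ) * L)
      (μ := volume) (f := g) (by push_cast; linarith) (fun x _ => hg0 x)
    push_cast at *
    linarith

/-- Uniqueness theorem: an almost periodic function whose Bohr means accumulate at zero for every
frequency vanishes identically. -/
theorem APR.eq_zero_of_mean {f : ℝ → ℂ} (hf : APR f)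
    (h0 : ∀ xi : ℝ, ∀ ε > 0, ∃ᶠ T : ℝ in atTop, ‖∫ x in (-T)..T, f x * waveR xi x‖ ≤ ε * T)
    (x₀ : ℝ) : f x₀ = 0 := by
  by_contra hx₀
  have hm : 0 < ‖f x₀‖ / 4 := by
    have := norm_pos_iff.2 hx₀
    positivity
  set m : ℝ := ‖f x₀‖ / 4 with hmdef
  obtain ⟨M, hM, hb⟩ := hf.exists_norm_le
  obtain ⟨δ₁, hδ₁, hd₁⟩ := hf.exists_norm_sub_le hm
  obtain ⟨l₁, hl₁, hτ₁⟩ := hf.2 m hm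
  have hsq : Continuous fun x => ‖f x‖ ^ 2 := (hf.1.norm).pow 2
  set L₁ : ℝ := l₁ + 2 * δ₁ with hL₁
  have hL₁0 : 0 < L₁ := by positivity
  have hlow : ∀ n : ℕ, n * (2 * δ₁ * m ^ 2) ≤ ∫ x in (0 : ℝ)..(n * L₁), ‖f x‖ ^ 2 := by
    intro n
    refine le_integral_of_relDense hsq (fun x => by positivity)
      (τ := {t | ∃ s, (∀ x, ‖f x - f (x + s)‖ ≤ m) ∧ t = x₀ + s}) hδ₁.le (l := l₁) ?_ ?_ le_rfl n
    · intro x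
      obtain ⟨t, ht, h1, h2⟩ := hτ₁ (x - x₀)
      exact ⟨x₀ + t, ⟨t, ht, rfl⟩, by linarith, by linarith⟩
    · rintro t ⟨s, hs, rfl⟩ r hr
      have h1 := hs x₀
      have h2 := hd₁ (x₀ + s) r hr
      have h3 := norm_sub_norm_le (f x₀) (f (x₀ + s))
      have h4 := norm_sub_norm_le (f (x₀ + s)) (f (x₀ + s + r))
      rw [norm_sub_rev] at h4
      have h5 : m ≤ ‖f (x₀ + s + r)‖ := by linarith
      gcongr
  set κ : ℝ := 2 * δ₁ * m ^ 2 / L₁ with hκ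
  have hκ0 : 0 < κ := by positivity
  set η : ℝ := κ / (2 * M) with hη
  have hη0 : 0 < η := by positivity
  obtain ⟨δ₂, hδ₂, hd₂⟩ := hf.exists_norm_sub_le (half_pos hη0)
  obtain ⟨l₂, hl₂, hτ₂⟩ := hf.2 (η / 2) (half_pos hη0)
  obtain ⟨k, hk⟩ := exists_nat_gt ((l₂ + 2 * δ₂) / L₁)
  have hk0 : (0 : ℝ) < k := lt_of_le_of_lt (by positivity) hk
  rw [div_lt_iff₀ hL₁0] at hk
  set ε : ℝ := Real.sqrt (δ₂ * κ ^ 2 / (16 * (k * L₁) * M ^ 2)) with hε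
  have hε0 : 0 < ε := by positivity
  have hεsq : ε ^ 2 = δ₂ * κ ^ 2 / (16 * (k * L₁) * M ^ 2) := Real.sq_sqrt (by positivity)
  obtain ⟨T₀, hT₀, huni⟩ := hf.exists_uniform h0 hε0
  obtain ⟨n, hn⟩ := exists_nat_gt (T₀ / (k * L₁))
  have hn0 : (0 : ℝ) < n := lt_of_le_of_lt (by positivity) hn
  rw [div_lt_iff₀ (by positivity)] at hn
  set T : ℝ := n * (k * L₁) with hT
  have hT0 : 0 < T := by positivity
  have hauto := integral_norm_sq_autocorrelation_le hf.1 hb hT0 (δ := ε * (2 * T))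
    (fun xi => huni xi (2 * T) (by linarith))
  set h : ℝ → ℂ := fun x => ∫ t in (0 : ℝ)..T, f (x + t) * (starRingEnd ℂ) (f t) with hh
  have hhc : Continuous h := by
    refine intervalIntegral.continuous_parametric_intervalIntegral_of_continuous' ?_ 0 T
    exact (hf.1.comp (continuous_fst.add continuous_snd)).mul
      (continuous_star.comp (hf.1.comp continuous_snd))
  have hE : κ * T ≤ ∫ x in (0 : ℝ)..T, ‖f x‖ ^ 2 := by
    have := hlow (n * k)
    push_cast at this
    rw [mul_assoc (n : ℝ) k L₁] at this
    refine le_trans (le_of_eq ?_) this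
    rw [hκ, hT]
    field_simp
  have hE' : ∫ x in (0 : ℝ)..T, ‖f x‖ ^ 2 ≤ M ^ 2 * T := by
    have := intervalIntegral.integral_mono_on (a := 0) (b := T) hT0.le
      (hsq.intervalIntegrable (μ := volume) _ _) (intervalIntegrable_const (μ := volume) (c := M ^ 2))
      (fun x _ => pow_le_pow_left₀ (norm_nonneg _) (hb x) 2)
    rwa [intervalIntegral.integral_const, smul_eq_mul, sub_zero, mul_comm T] at this
  have hhlow : ∀ s : ℝ, (∀ x, ‖f (s + x) - f x‖ ≤ η) → κ * T / 2 ≤ ‖h s‖ := by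
    intro s hs
    have hc1 : Continuous fun t => f (s + t) * (starRingEnd ℂ) (f t) :=
      (hf.1.comp (continuous_const_add s)).mul (continuous_star.comp hf.1)
    have hc2 : Continuous fun t => ((‖f t‖ ^ 2 : ℝ) : ℂ) := continuous_ofReal.comp hsq
    have h1 : h s - ((∫ x in (0 : ℝ)..T, ‖f x‖ ^ 2 : ℝ) : ℂ) =
        ∫ t in (0 : ℝ)..T, (f (s + t) - f t) * (starRingEnd ℂ) (f t) := by
      rw [← intervalIntegral.integral_ofReal, hh, ← intervalIntegral.integral_sub
        (hc1.intervalIntegrable _ _) (hc2.intervalIntegrable _ _)]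
      refine intervalIntegral.integral_congr fun t _ => ?_
      simp only [sub_mul, mul_conj, normSq_eq_norm_sq]
    have h2 : ‖h s - ((∫ x in (0 : ℝ)..T, ‖f x‖ ^ 2 : ℝ) : ℂ)‖ ≤ η * M * T := by
      rw [h1]
      have := intervalIntegral.norm_integral_le_of_norm_le_const (a := 0) (b := T) (C := η * M)
        (f := fun t => (f (s + t) - f t) * (starRingEnd ℂ) (f t)) (fun t _ => by
          rw [norm_mul, RCLike.norm_conj]
          exact mul_le_mul (hs t) (hb t) (norm_nonneg _) hη0.le)
      rwa [sub_zero, abs_of_pos hT0] at this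
    have h3 := norm_sub_norm_le ((∫ x in (0 : ℝ)..T, ‖f x‖ ^ 2 : ℝ) : ℂ) (h s)
    rw [norm_sub_rev, norm_real, Real.norm_of_nonneg (le_trans (by positivity) hE)] at h3
    have h4 : η * M * T = κ * T / 2 := by
      rw [hη]
      field_simp
    linarith
  have hlow₂ := le_integral_of_relDense (g := fun x => ‖h x‖ ^ 2) ((hhc.norm).pow 2)
    (fun x => by positivity) hδ₂.le hτ₂ (v := (κ * T / 2) ^ 2) (fun t ht s hs => by
      refine pow_le_pow_left₀ (by positivity) (hhlow (t + s) fun x => ?_) 2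
      have h1 := ht x
      have h2 := hd₂ (x + t) s hs
      rw [norm_sub_rev] at h1
      rw [show f (t + s + x) - f x = (f (x + t + s) - f (x + t)) + (f (x + t) - f x) by
        rw [show t + s + x = x + t + s by ring]; ring]
      exact (norm_add_le _ _).trans (by linarith)) hk.le n
  have hfinal : n * (2 * δ₂ * (κ * T / 2) ^ 2) ≤ (ε * (2 * T)) ^ 2 * (M ^ 2 * T) :=
    hlow₂.trans (hauto.trans (by gcongr))
  have h1 : (ε * (2 * T)) ^ 2 * (M ^ 2 * T) = n * (2 * δ₂ * (κ * T / 2) ^ 2) / 2 := by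
    rw [mul_pow, hεsq]
    conv_lhs => rw [show M ^ 2 * T = M ^ 2 * (n * (k * L₁)) from rfl]
    field_simp
    ring
  have h2 : 0 < n * (2 * δ₂ * (κ * T / 2) ^ 2) := by positivity
  linarith

/-- The Poisson kernel of the upper half-plane. -/
def poissonR (s t : ℝ) : ℝ := s / (Real.pi * (s ^ 2 + t ^ 2))

theorem poissonR_nonneg {s : ℝ} (hs : 0 < s) (t : ℝ) : 0 ≤ poissonR s t := by
  have := Real.pi_pos
  unfold poissonR
  positivity

theorem integrable_poissonR {s : ℝ} (hs : 0 < s) : Integrable (poissonR s) := by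
  have h := (integrable_inv_one_add_sq.comp_mul_left' (inv_ne_zero hs.ne')).const_mul
    (1 / (Real.pi * s))
  refine h.congr (Eventually.of_forall fun t => ?_)
  have := Real.pi_pos
  simp only [poissonR]
  field_simp

/-- The Fourier transform of the Poisson kernel. -/
theorem integral_poissonR_mul_waveR {s : ℝ} (hs : 0 < s) (xi : ℝ) :
    ∫ t : ℝ, (poissonR s t : ℂ) * waveR xi t =
      cexp (-(2 * (Real.pi : ℂ) * (s : ℂ) * ((|xi| : ℝ) : ℂ))) := by
  have hπ := Real.pi_pos
  set g : ℝ → ℂ := fun v => cexp (-(2 * (Real.pi : ℂ) * (s : ℂ) * ((|v| : ℝ) : ℂ))) with hg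
  have hgc : Continuous g := by
    simp only [hg]
    fun_prop
  have key : ∀ w : ℝ, Integrable (fun v : ℝ => cexp (((-2 * Real.pi * v * w : ℝ) : ℂ) * I) • g v) ∧
      ∫ v : ℝ, cexp (((-2 * Real.pi * v * w : ℝ) : ℂ) * I) • g v = (poissonR s w : ℂ) := by
    intro w
    set a : ℂ := -(2 * Real.pi * s) - 2 * Real.pi * w * I with ha
    set b : ℂ := 2 * Real.pi * s - 2 * Real.pi * w * I with hb
    have har : a.re < 0 := by
      simp only [ha, sub_re, neg_re, mul_re, re_ofNat, ofReal_re, im_ofNat, ofReal_im, mul_zero,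
        sub_zero, mul_im, zero_mul, add_zero, I_re, I_im, neg_lt_zero, mul_one]
      positivity
    have hbr : 0 < b.re := by
      simp only [hb, sub_re, mul_re, re_ofNat, ofReal_re, im_ofNat, ofReal_im, mul_zero,
        sub_zero, mul_im, zero_mul, add_zero, I_re, I_im, mul_one]
      positivity
    have h1 : EqOn (fun v : ℝ => cexp (((-2 * Real.pi * v * w : ℝ) : ℂ) * I) • g v)
        (fun v : ℝ => cexp (a * v)) (Ioi 0) := by
      intro v hv
      simp only [hg, smul_eq_mul, ← exp_add, abs_of_pos (mem_Ioi.1 hv), ha]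
      congr 1
      push_cast
      ring
    have h2 : EqOn (fun v : ℝ => cexp (((-2 * Real.pi * v * w : ℝ) : ℂ) * I) • g v)
        (fun v : ℝ => cexp (b * v)) (Iic 0) := by
      intro v hv
      simp only [hg, smul_eq_mul, ← exp_add, abs_of_nonpos (mem_Iic.1 hv), hb]
      congr 1
      push_cast
      ring
    have i1 := (integrableOn_exp_mul_complex_Ioi har 0).congr_fun h1.symm measurableSet_Ioi
    have i2 := (integrableOn_exp_mul_complex_Iic hbr 0).congr_fun h2.symm measurableSet_Iic
    refine ⟨?_, ?_⟩
    · rw [← integrableOn_univ, ← Iic_union_Ioi (a := (0 : ℝ))]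
      exact i2.union i1
    · rw [← intervalIntegral.integral_Iic_add_Ioi i2 i1, setIntegral_congr_fun measurableSet_Ioi h1,
        setIntegral_congr_fun measurableSet_Iic h2, integral_exp_mul_complex_Ioi har,
        integral_exp_mul_complex_Iic hbr]
      have ha0 : a ≠ 0 := fun h => by simp [h] at har
      have hb0 : b ≠ 0 := fun h => by simp [h] at hbr
      have hab : a * b = -(4 * Real.pi ^ 2 * (s ^ 2 + w ^ 2)) := by
        rw [ha, hb]
        linear_combination 4 * (Real.pi : ℂ) ^ 2 * w ^ 2 * I_sq
      have hsw : (s : ℂ) ^ 2 + (w : ℂ) ^ 2 ≠ 0 := by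
        have : s ^ 2 + w ^ 2 ≠ 0 := by positivity
        exact_mod_cast this
      have hπc : (Real.pi : ℂ) ≠ 0 := by exact_mod_cast hπ.ne'
      rw [ofReal_zero, mul_zero, mul_zero, exp_zero, poissonR, div_add_div _ _ hb0 ha0,
        mul_comm b a, hab]
      push_cast
      rw [div_eq_div_iff (by simpa [hπc] using hsw) (mul_ne_zero hπc hsw), ha, hb]
      ring
  have hFg : FourierTransform.fourier g = fun w => (poissonR s w : ℂ) := by
    ext w
    rw [Real.fourier_real_eq_integral_exp_smul, (key w).2]
  have hgi : Integrable g := by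
    simpa using (key 0).1
  have h := hgc.fourierInv_fourier_eq hgi (by rw [hFg]; exact (integrable_poissonR hs).ofReal)
  have h1 := congrFun h (-xi)
  rw [hFg, Real.fourierInv_eq'] at h1
  simp only [hg, abs_neg] at h1
  rw [← h1]
  congr 1
  ext t
  rw [smul_eq_mul, mul_comm, waveR]
  congr 2
  simp
  ring

theorem integral_poissonR {s : ℝ} (hs : 0 < s) : ∫ t : ℝ, poissonR s t = 1 := by
  have h := integral_poissonR_mul_waveR hs 0
  simp only [waveR, ofReal_zero, mul_zero, zero_mul, neg_zero, exp_zero, mul_one, abs_zero,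
    integral_complex_ofReal] at h
  exact_mod_cast h

/-- The mean of a convolution is asymptotically the mean of the function times the Fourier
transform of the kernel. -/
theorem tendsto_mean_conv {k f : ℝ → ℂ} (hk : Integrable k) (hf : Continuous f) {M : ℝ}
    (hM : ∀ x, ‖f x‖ ≤ M) (xi : ℝ) :
    Tendsto (fun T : ℝ => (T⁻¹ : ℂ) * (∫ x in (-T)..T, (∫ t, k t * f (x - t)) * waveR xi x) -
      (∫ t, k t * waveR xi t) * ((T⁻¹ : ℂ) * ∫ x in (-T)..T, f x * waveR xi x)) atTop (𝓝 0) := by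
  have hM0 : 0 ≤ M := (norm_nonneg _).trans (hM 0)
  have hc : Continuous fun x => f x * waveR xi x := hf.mul (continuous_waveR xi)
  have hcM : ∀ x, ‖f x * waveR xi x‖ ≤ M := fun x => by
    rw [norm_mul, norm_waveR, mul_one]; exact hM x
  set E : ℝ → ℝ → ℂ := fun T t =>
    (T⁻¹ : ℂ) * ((∫ x in (-T + -t)..(T + -t), f x * waveR xi x) -
      ∫ x in (-T)..T, f x * waveR xi x) with hE
  have hshift : ∀ T : ℝ, Continuous fun t => ∫ x in (-T + -t)..(T + -t), f x * waveR xi x := by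
    intro T
    have h1 : (fun t => ∫ x in (-T + -t)..(T + -t), f x * waveR xi x) =
        fun t => ∫ x in (-T)..T, f (x + -t) * waveR xi (x + -t) := by
      ext t
      rw [← intervalIntegral.integral_comp_add_right (fun x => f x * waveR xi x)]
    have h2 : Continuous (Function.uncurry fun t x : ℝ => f (x + -t) * waveR xi (x + -t)) :=
      hc.comp (by fun_prop : Continuous fun p : ℝ × ℝ => p.2 + -p.1)
    rw [h1]
    exact intervalIntegral.continuous_parametric_intervalIntegral_of_continuous' h2 _ _
  have hEc : ∀ T, Continuous (E T) := fun T =>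
    continuous_const.mul ((hshift T).sub continuous_const)
  have hE1 : ∀ T > 0, ∀ t, ‖E T t‖ ≤ 2 * M * |t| * T⁻¹ := by
    intro T hT t
    have := norm_integral_shift_sub_le hc hcM (-T) T (-t)
    rw [abs_neg] at this
    simp only [hE]
    rw [norm_mul, norm_inv, norm_real, Real.norm_of_nonneg hT.le, mul_comm]
    gcongr
  have hE2 : ∀ T > 0, ∀ t, ‖E T t‖ ≤ 4 * M := by
    intro T hT t
    have h1 := intervalIntegral.norm_integral_le_of_norm_le_const (a := -T + -t) (b := T + -t)
      (fun x _ => hcM x)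
    have h2 := intervalIntegral.norm_integral_le_of_norm_le_const (a := -T) (b := T)
      (fun x _ => hcM x)
    rw [show T + -t - (-T + -t) = 2 * T by ring, abs_of_pos (by positivity)] at h1
    rw [show T - -T = 2 * T by ring, abs_of_pos (by positivity)] at h2
    simp only [hE]
    rw [norm_mul, norm_inv, norm_real, Real.norm_of_nonneg hT.le, inv_mul_le_iff₀ hT]
    refine (norm_sub_le _ _).trans ?_
    linarith
  have hlim : Tendsto (fun T : ℝ => ∫ t, k t * waveR xi t * E T t) atTop (𝓝 (∫ _ : ℝ, (0 : ℂ))) := by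
    refine tendsto_integral_filter_of_dominated_convergence (fun t => ‖k t‖ * (4 * M)) ?_ ?_
      (hk.norm.mul_const _) ?_
    · exact Eventually.of_forall fun T => (hk.1.mul
        (continuous_waveR xi).aestronglyMeasurable).mul (hEc T).aestronglyMeasurable
    · filter_upwards [eventually_gt_atTop 0] with T hT
      refine Eventually.of_forall fun t => ?_
      rw [norm_mul, norm_mul, norm_waveR, mul_one]
      gcongr
      exact hE2 T hT t
    · refine Eventually.of_forall fun t => ?_
      refine squeeze_zero_norm' (a := fun T => ‖k t‖ * (2 * M * |t|) * T⁻¹) ?_ ?_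
      · filter_upwards [eventually_gt_atTop 0] with T hT
        rw [norm_mul, norm_mul, norm_waveR, mul_one, mul_assoc ‖k t‖]
        gcongr
        exact hE1 T hT t
      · simpa using tendsto_inv_atTop_zero.const_mul (‖k t‖ * (2 * M * |t|))
  rw [integral_zero] at hlim
  refine hlim.congr' ?_
  filter_upwards [eventually_gt_atTop 0] with T hT
  have hswap : ∫ x in (-T)..T, (∫ t, k t * f (x - t)) * waveR xi x =
      ∫ t, k t * waveR xi t * ∫ x in (-T + -t)..(T + -t), f x * waveR xi x := by
    simp only [← integral_mul_const]
    rw [intervalIntegral_integral_swap]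
    · congr 1
      ext t
      rw [← intervalIntegral.integral_comp_add_right, ← intervalIntegral.integral_const_mul]
      refine intervalIntegral.integral_congr fun x _ => ?_
      have : waveR xi x = waveR xi t * waveR xi (x + -t) := by
        rw [← waveR_add]
        ring_nf
      simp only [this, sub_eq_add_neg]
      ring
    · have hfin : IsFiniteMeasure (volume.restrict (uIoc (-T) T)) := by
        rw [uIoc_of_le (by linarith)]
        infer_instance
      have h1 : Integrable (fun p : ℝ × ℝ => k p.2) ((volume.restrict (uIoc (-T) T)).prod volume) :=
        hk.comp_snd _
      have h2 := h1.mul_bdd (c := M) (f := fun p : ℝ × ℝ => k p.2)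
        (g := fun p : ℝ × ℝ => f (p.1 - p.2) * waveR xi p.1)
        ((hf.comp (continuous_fst.sub continuous_snd)).mul
          ((continuous_waveR xi).comp continuous_fst)).aestronglyMeasurable
        (Eventually.of_forall fun p => by
          rw [norm_mul, norm_waveR, mul_one]
          exact hM _)
      refine h2.congr (Eventually.of_forall fun p => ?_)
      simp only [Function.uncurry]
      ring
  rw [hswap, ← integral_const_mul, ← integral_mul_const, ← integral_sub]
  · congr 1
    ext t
    simp only [hE]
    ring
  · have h1 := hshift T
    have h5 : Integrable fun t => k t * waveR xi t :=
      hk.mul_bdd (c := 1) (continuous_waveR xi).aestronglyMeasurable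
        (Eventually.of_forall fun t => (norm_waveR xi t).le)
    refine (h5.mul_bdd (c := M * (2 * T)) h1.aestronglyMeasurable
      (Eventually.of_forall fun t => ?_)).const_mul _
    have h1 := intervalIntegral.norm_integral_le_of_norm_le_const (a := -T + -t) (b := T + -t)
      (fun x _ => hcM x)
    rwa [show T + -t - (-T + -t) = 2 * T by ring, abs_of_pos (by positivity)] at h1
  · have h5 : Integrable fun t => k t * waveR xi t :=
      hk.mul_bdd (c := 1) (continuous_waveR xi).aestronglyMeasurable
        (Eventually.of_forall fun t => (norm_waveR xi t).le)
    exact h5.mul_const _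

theorem lineMean_eq (f : ℂ → ℂ) (y lam T : ℝ) :
    lineMean f y lam T = cexp (2 * (Real.pi : ℂ) * (lam : ℂ) * (y : ℂ)) / 2 *
      ((T⁻¹ : ℂ) * ∫ x in (-T)..T, f ((x : ℂ) + (y : ℂ) * I) * waveR lam x) := by
  have h : ∀ x : ℝ, f ((x : ℂ) + (y : ℂ) * I) *
      cexp (-(2 * (Real.pi : ℂ) * I * (lam : ℂ) * ((x : ℂ) + (y : ℂ) * I))) =
      cexp (2 * (Real.pi : ℂ) * (lam : ℂ) * (y : ℂ)) *
        (f ((x : ℂ) + (y : ℂ) * I) * waveR lam x) := by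
    intro x
    rw [waveR, mul_left_comm, ← exp_add]
    congr 2
    linear_combination -(2 * (Real.pi : ℂ) * lam * y) * I_sq
  simp only [lineMean, h]
  rw [intervalIntegral.integral_const_mul, one_div, mul_inv]
  ring

theorem APH.apr_line {f : ℂ → ℂ} (hf : APH f) {y : ℝ} (hy : 0 < y) :
    APR fun x : ℝ => f ((x : ℂ) + (y : ℂ) * I) := by
  refine ⟨continuous_comp_line hf.1.continuousOn hy, fun ε hε => ?_⟩
  obtain ⟨τ, ⟨l, hl, h1⟩, h2⟩ := hf.2 (y / 2) (2 * y) ε (by linarith) (by linarith) hε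
  refine ⟨l, hl, fun x => ?_⟩
  obtain ⟨t, ht, h3⟩ := h1 x
  refine ⟨t, fun x => ?_, h3⟩
  have := h2 t ht ((x : ℂ) + (y : ℂ) * I) (by simp; linarith) (by simp; linarith)
  beta_reduce
  rw [ofReal_add, add_right_comm]
  exact this

/-- A modulated Poisson kernel whose Fourier transform equals `e^{-2πsλ}` for `λ ≥ B`. -/
def poissonMod (B s t : ℝ) : ℂ :=
  cexp (-(2 * (Real.pi : ℂ) * (B : ℂ) * (s : ℂ))) * ((poissonR s t : ℂ) * waveR (-B) t)

theorem integrable_poissonMod (B : ℝ) {s : ℝ} (hs : 0 < s) : Integrable (poissonMod B s) :=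
  ((integrable_poissonR hs).ofReal.mul_bdd (c := 1) (continuous_waveR _).aestronglyMeasurable
    (Eventually.of_forall fun t => (norm_waveR _ t).le)).const_mul _

theorem norm_poissonMod (B : ℝ) {s : ℝ} (hs : 0 < s) (t : ℝ) :
    ‖poissonMod B s t‖ = Real.exp (-(2 * Real.pi * B * s)) * poissonR s t := by
  rw [poissonMod, norm_mul, norm_mul, norm_waveR, mul_one, norm_real,
    Real.norm_of_nonneg (poissonR_nonneg hs t), norm_exp]
  congr 2
  simp

theorem integral_norm_poissonMod (B : ℝ) {s : ℝ} (hs : 0 < s) :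
    ∫ t, ‖poissonMod B s t‖ = Real.exp (-(2 * Real.pi * B * s)) := by
  simp only [norm_poissonMod B hs]
  rw [integral_const_mul, integral_poissonR hs, mul_one]

theorem integral_poissonMod_mul_waveR {B s lam : ℝ} (hs : 0 < s) (h : B ≤ lam) :
    ∫ t, poissonMod B s t * waveR lam t = cexp (-(2 * (Real.pi : ℂ) * (lam : ℂ) * (s : ℂ))) := by
  have h1 : ∀ t, poissonMod B s t * waveR lam t =
      cexp (-(2 * (Real.pi : ℂ) * (B : ℂ) * (s : ℂ))) *
        ((poissonR s t : ℂ) * waveR (lam - B) t) := by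
    intro t
    rw [poissonMod, sub_eq_neg_add, waveR_add_left]
    ring
  simp only [h1]
  rw [integral_const_mul, integral_poissonR_mul_waveR hs, ← exp_add, abs_of_nonneg (by linarith)]
  congr 1
  push_cast
  ring

/-- If the means of `f` below `B` vanish along some filter, then `f` decays like `e^{-2πBy}`. -/
theorem APH.norm_le_of_means {f : ℂ → ℂ} (hf : APH f) {U : Filter ℝ} [NeBot U] (hU : U ≤ atTop)
    {B : ℝ} (h0 : ∀ lam < B, Tendsto (lineMean f 1 lam) U (𝓝 0)) :
    ∃ C > 0, ∀ z : ℂ, 1 ≤ z.im → ‖f z‖ ≤ C * Real.exp (-(2 * Real.pi * B * z.im)) := by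
  have hg := hf.apr_line one_pos
  obtain ⟨M, hM, hb⟩ := hg.exists_norm_le
  set g : ℝ → ℂ := fun x => f ((x : ℂ) + ((1 : ℝ) : ℂ) * I) with hgdef
  refine ⟨M * Real.exp (2 * Real.pi * B), by positivity, fun z hz => ?_⟩
  rw [mul_assoc, ← Real.exp_add]
  have hzz : z = (z.re : ℂ) + (z.im : ℂ) * I := (re_add_im z).symm
  rcases hz.eq_or_lt with hz1 | hz1
  · have := hb z.re
    rw [hz1, ← hzz] at this
    rw [← hz1]
    simpa using this
  set y := z.im with hy
  set s := y - 1 with hs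
  have hs0 : 0 < s := by linarith
  have hy0 : 0 < y := by linarith
  set k := poissonMod B s with hk
  have hki : Integrable k := integrable_poissonMod B hs0
  have hconv : ∀ x, Integrable fun t => k t * g (x - t) := fun x =>
    hki.mul_bdd (c := M) (hg.1.comp (by fun_prop)).aestronglyMeasurable
      (Eventually.of_forall fun t => hb _)
  set D : ℝ → ℂ := fun x => f ((x : ℂ) + (y : ℂ) * I) - ∫ t, k t * g (x - t) with hD
  have hcc : Continuous fun x => ∫ t, k t * g (x - t) := by
    refine continuous_of_dominated (bound := fun t => ‖k t‖ * M)
      (fun x => (hconv x).aestronglyMeasurable) (fun x => Eventually.of_forall fun t => ?_)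
      (hki.norm.mul_const _) (Eventually.of_forall fun t => ?_)
    · rw [norm_mul]
      gcongr
      exact hb _
    · exact continuous_const.mul (hg.1.comp (by fun_prop))
  have hlc := continuous_comp_line hf.1.continuousOn hy0
  have hDapr : APR D := by
    refine ⟨hlc.sub hcc, fun ε hε => ?_⟩
    set K := ∫ t, ‖k t‖ with hK
    have hK0 : 0 ≤ K := integral_nonneg fun t => norm_nonneg _
    obtain ⟨τ, ⟨l, hl, h1⟩, h2⟩ := hf.2 (1 / 2) (y + 1) (ε / (1 + K)) (by norm_num) (by linarith)
      (by positivity)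
    refine ⟨l, hl, fun x => ?_⟩
    obtain ⟨t, ht, h3⟩ := h1 x
    refine ⟨t, fun x => ?_, h3⟩
    have e1 : ‖f ((x : ℂ) + (y : ℂ) * I) - f (((x + t : ℝ) : ℂ) + (y : ℂ) * I)‖ ≤ ε / (1 + K) := by
      rw [ofReal_add, add_right_comm]
      exact h2 t ht _ (by simp; linarith) (by simp)
    have e2 : ∀ u, ‖g (x - u) - g (x + t - u)‖ ≤ ε / (1 + K) := by
      intro u
      have := h2 t ht (((x - u : ℝ) : ℂ) + ((1 : ℝ) : ℂ) * I) (by simp; norm_num) (by simp; linarith)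
      simp only [hgdef]
      convert this using 4
      push_cast
      ring
    have e3 : ‖(∫ u, k u * g (x - u)) - ∫ u, k u * g (x + t - u)‖ ≤ K * (ε / (1 + K)) := by
      rw [← integral_sub (hconv _) (hconv _), hK, ← integral_mul_const]
      refine norm_integral_le_of_norm_le (hki.norm.mul_const _) (Eventually.of_forall fun u => ?_)
      rw [← mul_sub, norm_mul]
      gcongr
      exact e2 u
    calc ‖D x - D (x + t)‖ = ‖(f ((x : ℂ) + (y : ℂ) * I) - f (((x + t : ℝ) : ℂ) + (y : ℂ) * I)) -
          ((∫ u, k u * g (x - u)) - ∫ u, k u * g (x + t - u))‖ := by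
            simp only [hD]
            congr 1
            ring
      _ ≤ ε / (1 + K) + K * (ε / (1 + K)) := (norm_sub_le _ _).trans (add_le_add e1 e3)
      _ = ε := by field_simp
  obtain ⟨M', hM', hb'⟩ := hf.exists_norm_le (α := 1) (β := y) one_pos hz1
  have hmean : ∀ xi : ℝ, Tendsto (fun T : ℝ => (T⁻¹ : ℂ) * ∫ x in (-T)..T, D x * waveR xi x) U
      (𝓝 0) := by
    intro xi
    set A : ℝ → ℂ := fun T => (T⁻¹ : ℂ) * ∫ x in (-T)..T, g x * waveR xi x with hA
    set H : ℝ → ℂ := fun T => (T⁻¹ : ℂ) * ∫ x in (-T)..T, f ((x : ℂ) + (y : ℂ) * I) * waveR xi x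
      with hH
    have t1 : Tendsto (fun T => H T - cexp (-(2 * (Real.pi : ℂ) * (xi : ℂ) * (s : ℂ))) * A T) U
        (𝓝 0) := by
      have := ((tendsto_lineMean_sub hf.1 hy0 one_pos (M := M') (fun z hz => by
        rw [uIcc_of_ge hz1.le] at hz
        exact hb' z hz.1 hz.2) xi).mono_left hU).const_mul
        (2 * cexp (-(2 * (Real.pi : ℂ) * (xi : ℂ) * (y : ℂ))))
      rw [mul_zero] at this
      refine this.congr fun T => ?_
      rw [lineMean_eq, lineMean_eq]
      have e1 : cexp (-(2 * (Real.pi : ℂ) * (xi : ℂ) * (y : ℂ))) *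
          cexp (2 * (Real.pi : ℂ) * (xi : ℂ) * (y : ℂ)) = 1 := by
        rw [← exp_add, neg_add_cancel, exp_zero]
      have e2 : cexp (-(2 * (Real.pi : ℂ) * (xi : ℂ) * (y : ℂ))) *
          cexp (2 * (Real.pi : ℂ) * (xi : ℂ) * ((1 : ℝ) : ℂ)) =
          cexp (-(2 * (Real.pi : ℂ) * (xi : ℂ) * (s : ℂ))) := by
        rw [← exp_add, hs]
        push_cast
        ring_nf
      linear_combination (H T) * e1 - (A T) * e2
    have t2 := (tendsto_mean_conv hki hg.1 hb xi).mono_left hU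
    have t3 : Tendsto (fun T => (cexp (-(2 * (Real.pi : ℂ) * (xi : ℂ) * (s : ℂ))) -
        ∫ t, k t * waveR xi t) * A T) U (𝓝 0) := by
      rcases lt_or_ge xi B with h | h
      · have hA0 : Tendsto A U (𝓝 0) := by
          have := (h0 xi h).const_mul
            (2 * cexp (-(2 * (Real.pi : ℂ) * (xi : ℂ) * ((1 : ℝ) : ℂ))))
          rw [mul_zero] at this
          refine this.congr fun T => ?_
          rw [lineMean_eq]
          have e1 : cexp (-(2 * (Real.pi : ℂ) * (xi : ℂ) * ((1 : ℝ) : ℂ))) *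
              cexp (2 * (Real.pi : ℂ) * (xi : ℂ) * ((1 : ℝ) : ℂ)) = 1 := by
            rw [← exp_add, neg_add_cancel, exp_zero]
          linear_combination (A T) * e1
        simpa using hA0.const_mul (cexp (-(2 * (Real.pi : ℂ) * (xi : ℂ) * (s : ℂ))) -
          ∫ t, k t * waveR xi t)
      · rw [hk, integral_poissonMod_mul_waveR hs0 h]
        simp
    have t4 := (t1.sub t2).add t3
    simp only [sub_zero, add_zero] at t4
    refine t4.congr fun T => ?_
    have hi1 : IntervalIntegrable (fun x : ℝ => f ((x : ℂ) + (y : ℂ) * I) * waveR xi x) volume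
        (-T) T := (hlc.mul (continuous_waveR xi)).intervalIntegrable _ _
    have hi2 : IntervalIntegrable (fun x : ℝ => (∫ t, k t * g (x - t)) * waveR xi x) volume
        (-T) T := (hcc.mul (continuous_waveR xi)).intervalIntegrable _ _
    simp only [hD, sub_mul]
    rw [intervalIntegral.integral_sub hi1 hi2]
    simp only [hH, hA]
    ring
  have hzero := hDapr.eq_zero_of_mean (fun xi ε hε => by
    have h1 := (Metric.tendsto_nhds.1 (hmean xi) ε hε).and
      ((eventually_gt_atTop (0 : ℝ)).filter_mono hU)
    refine (h1.frequently.filter_mono hU).mono fun T hT => ?_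
    have h2 := hT.1.le
    rw [dist_zero_right, norm_mul, norm_inv, norm_real, Real.norm_of_nonneg hT.2.le,
      inv_mul_le_iff₀ hT.2] at h2
    linarith) z.re
  have hfz : f z = ∫ t, k t * g (z.re - t) := by
    have := sub_eq_zero.1 hzero
    rwa [hy, ← hzz] at this
  rw [hfz]
  calc ‖∫ t, k t * g (z.re - t)‖ ≤ ∫ t, ‖k t‖ * M := by
        refine norm_integral_le_of_norm_le (hki.norm.mul_const _) (Eventually.of_forall fun u => ?_)
        rw [norm_mul]
        gcongr
        exact hb _
    _ = M * Real.exp (2 * Real.pi * B + -(2 * Real.pi * B * y)) := by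
        rw [integral_mul_const, hk, integral_norm_poissonMod B hs0, hs, mul_comm]
        ring_nf

/-- A zero-free almost periodic function of bounded exponential growth admits an exponential lower
bound. -/
theorem APH.norm_inv_le {f : ℂ → ℂ} (hf : APH f) (hnz : ∀ z ∈ UHP, f z ≠ 0) {C B : ℝ}
    (hC : 0 < C) (h : ∀ z : ℂ, 1 ≤ z.im → ‖f z‖ ≤ C * Real.exp (-(2 * Real.pi * B * z.im))) :
    ∃ C' > 0, ∃ B' : ℝ, ∀ z : ℂ, 2 ≤ z.im →
      ‖(f z)⁻¹‖ ≤ C' * Real.exp (-(2 * Real.pi * B' * z.im)) := by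
  have hπ := Real.pi_pos
  obtain ⟨c, hc, hcb⟩ := hf.exists_le_norm hnz (α := 2) (β := 3) (by norm_num) (by norm_num)
  set F : ℂ → ℂ := fun z => f z * cexp (-(2 * (Real.pi : ℂ) * I * (B : ℂ) * z)) with hF
  have hFn : ∀ z, ‖F z‖ = ‖f z‖ * Real.exp (2 * Real.pi * B * z.im) := fun z => by
    rw [hF, norm_mul, norm_cexp_neg_two_pi_mul]
  have hFC : ∀ z : ℂ, 1 ≤ z.im → ‖F z‖ ≤ C := fun z hz => by
    rw [hFn, ← le_div_iff₀ (Real.exp_pos _), div_eq_mul_inv, ← Real.exp_neg]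
    exact h z hz
  have hFd : DifferentiableOn ℂ F UHP := hf.1.mul (by fun_prop)
  have hFnz : ∀ z ∈ UHP, F z ≠ 0 := fun z hz => mul_ne_zero (hnz z hz) (exp_ne_zero _)
  set c' := c * Real.exp (2 * Real.pi * B * 2) with hc'
  have hc'0 : 0 < c' := by positivity
  set L := Real.log (C / c') with hL
  refine ⟨C⁻¹ * Real.exp (-3 * L), by positivity, -B - L / Real.pi, fun z hz => ?_⟩
  set w : ℂ := (z.re : ℂ) + ((2 : ℝ) : ℂ) * I with hw
  have hwim : w.im = 2 := by simp [hw]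
  have hdist : dist w z = z.im - 2 := by
    rw [dist_of_re_eq (by simp [hw]), hwim, Real.dist_eq, abs_sub_comm, abs_of_nonneg (by linarith)]
  have hball : ∀ v ∈ Metric.ball z (z.im - 1), 1 ≤ v.im := by
    intro v hv
    rw [Metric.mem_ball, dist_eq_norm] at hv
    have := (abs_im_le_norm (v - z)).trans hv.le
    rw [sub_im, abs_le] at this
    linarith
  have hballU : Metric.ball z (z.im - 1) ⊆ UHP := fun v hv => lt_of_lt_of_le one_pos (hball v hv)
  have hH := log_div_norm_center_le hC (hFd.mono hballU) (fun v hv => hFnz v (hballU hv))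
    (fun v hv => hFC v (hball v hv)) (w := w) (by rw [Metric.mem_ball, hdist]; linarith)
  rw [hdist] at hH
  have hFw : c' ≤ ‖F w‖ := by
    rw [hFn, hwim, hc']
    gcongr
    exact hcb w hwim.ge (by rw [hwim]; norm_num)
  have hFw0 : 0 < ‖F w‖ := hc'0.trans_le hFw
  have hzU : z ∈ UHP := lt_of_lt_of_le two_pos hz
  have hFz0 : 0 < ‖F z‖ := norm_pos_iff.2 (hFnz z hzU)
  have hLw : Real.log (C / ‖F w‖) ≤ L := Real.log_le_log (by positivity) (by gcongr)
  have h1 : Real.log (C / ‖F z‖) ≤ (2 * z.im - 3) * L := by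
    have : (2 * z.im - 3) * Real.log (C / ‖F w‖) ≤ (2 * z.im - 3) * L :=
      mul_le_mul_of_nonneg_left hLw (by linarith)
    linarith
  have h2 : C / ‖F z‖ ≤ Real.exp ((2 * z.im - 3) * L) := (Real.log_le_iff_le_exp (by positivity)).1 h1
  have hfz0 : 0 < ‖f z‖ := norm_pos_iff.2 (hnz z hzU)
  have h3 : ‖(f z)⁻¹‖ = C⁻¹ * (C / ‖F z‖) * Real.exp (2 * Real.pi * B * z.im) := by
    rw [norm_inv, hFn]
    field_simp
  rw [h3]
  calc C⁻¹ * (C / ‖F z‖) * Real.exp (2 * Real.pi * B * z.im)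
      ≤ C⁻¹ * Real.exp ((2 * z.im - 3) * L) * Real.exp (2 * Real.pi * B * z.im) := by gcongr
    _ = _ := by
      rw [mul_assoc C⁻¹, mul_assoc C⁻¹, ← Real.exp_add, ← Real.exp_add]
      congr 2
      field_simp
      ring

theorem APH.norm_le_of_lowerBound {f : ℂ → ℂ} (hf : APH f) {B : ℝ}
    (hB : B ∈ lowerBounds (specH f)) :
    ∃ C > 0, ∀ z : ℂ, 1 ≤ z.im → ‖f z‖ ≤ C * Real.exp (-(2 * Real.pi * B * z.im)) :=
  hf.norm_le_of_means le_rfl fun lam hlam => by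
    by_contra h
    exact hlam.not_ge (hB ⟨1, one_pos, h⟩)

theorem APH.bddBelow_specH_inv {f : ℂ → ℂ} (hf : APH f) (hnz : ∀ z ∈ UHP, f z ≠ 0)
    (hbdd : BddBelow (specH f)) : BddBelow (specH fun z => (f z)⁻¹) := by
  obtain ⟨B, hB⟩ := hbdd
  obtain ⟨C, hC, h⟩ := hf.norm_le_of_lowerBound hB
  obtain ⟨C', -, B', h'⟩ := hf.norm_inv_le hnz hC h
  refine ⟨B', fun lam hlam => le_of_not_gt fun hlt => ?_⟩
  simpa using specH_subset_of_norm_sub_trigEval_le (hf.inv hnz) 0 (B := B') (C := C') (Y := 2)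
    (fun z hz => by simpa using h' z hz) hlam hlt

theorem APH.add_cexp {f : ℂ → ℂ} (hf : APH f) (mu : ℝ) (a : ℂ) :
    APH fun z => f z + a * cexp (2 * (Real.pi : ℂ) * I * (mu : ℂ) * z) := by
  refine ⟨hf.1.add (by fun_prop), fun α β ε hα hαβ hε => ?_⟩
  obtain ⟨τ, ⟨l, hl, hτ⟩, h⟩ := hf.2 α β (ε / 4) hα hαβ (by positivity)
  set φ : ℝ → ℂ := fun t => cexp (2 * (Real.pi : ℂ) * I * (mu : ℂ) * (t : ℂ)) with hφ
  have hφn : ∀ t, ‖φ t‖ = 1 := fun t => by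
    rw [hφ, norm_cexp_two_pi_mul]
    simp
  set K := ‖a‖ * Real.exp (2 * Real.pi * |mu| * β) with hK
  have hK0 : 0 ≤ K := by positivity
  have htb : TotallyBounded (φ '' τ) := (isCompact_sphere (0 : ℂ) 1).totallyBounded.subset (by
    rintro _ ⟨t, -, rfl⟩
    simp [hφn])
  obtain ⟨S, hSτ, hSfin, hS⟩ := Metric.finite_approx_of_totallyBounded htb
    (ε / (2 * (K + 1))) (by positivity)
  have hSτ' : ∀ y ∈ S, ∃ t, t ∈ τ ∧ φ t = y := fun y hy => hSτ hy
  choose! u hu hu' using hSτ'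
  obtain ⟨m, hm⟩ := (hSfin.image fun y => |u y|).bddAbove
  have hm' : ∀ y ∈ S, |u y| ≤ |m| := fun y hy =>
    (hm (mem_image_of_mem _ hy)).trans (le_abs_self m)
  refine ⟨{t | ∃ s ∈ τ, ∃ y ∈ S, dist (φ s) y < ε / (2 * (K + 1)) ∧ t = s - u y},
    ⟨l + 2 * |m|, by positivity, fun x => ?_⟩, ?_⟩
  · obtain ⟨s, hs, h1, h2⟩ := hτ (x + |m|)
    have h3 := hS (mem_image_of_mem φ hs)
    simp only [mem_iUnion, Metric.mem_ball, exists_prop] at h3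
    obtain ⟨y, hy, h4⟩ := h3
    have h5 := abs_le.1 (hm' y hy)
    exact ⟨s - u y, ⟨s, hs, y, hy, h4, rfl⟩, by linarith, by linarith⟩
  · rintro _ ⟨s, hs, y, hy, hsy, rfl⟩ z hz1 hz2
    set v := u y with hv
    have hvy : φ v = y := hu' y hy
    have e1 := h s hs (z - (v : ℂ)) (by simpa using hz1) (by simpa using hz2)
    have e2 := h v (hu y hy) (z - (v : ℂ)) (by simpa using hz1) (by simpa using hz2)
    rw [sub_add_cancel] at e2
    have e3 : ‖f z - f (z + ((s - v : ℝ) : ℂ))‖ ≤ ε / 4 + ε / 4 := by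
      have h6 : f z - f (z + ((s - v : ℝ) : ℂ)) = (f (z - (v : ℂ)) - f (z - (v : ℂ) + (s : ℂ))) -
          (f (z - (v : ℂ)) - f z) := by
        push_cast
        ring_nf
      rw [h6]
      exact (norm_sub_le _ _).trans (add_le_add e1 e2)
    have e4 : ‖1 - φ (s - v)‖ ≤ ε / (2 * (K + 1)) := by
      have h6 : φ s = φ v * φ (s - v) := by
        simp only [hφ]
        rw [← exp_add]
        push_cast
        ring_nf
      rw [← hvy, dist_comm, dist_eq_norm, h6] at hsy
      have h7 : φ v - φ v * φ (s - v) = φ v * (1 - φ (s - v)) := by ring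
      rw [h7, norm_mul, hφn, one_mul] at hsy
      exact hsy.le
    have e5 : ‖a * cexp (2 * (Real.pi : ℂ) * I * (mu : ℂ) * z)‖ ≤ K := by
      rw [norm_mul, norm_cexp_two_pi_mul, hK]
      gcongr
      have h8 := Real.pi_pos
      have h9 : 0 < z.im := hα.trans hz1
      calc -(2 * Real.pi * mu * z.im) = 2 * Real.pi * (-mu) * z.im := by ring
        _ ≤ 2 * Real.pi * |mu| * β := by
          gcongr
          exact neg_le_abs mu
    have e6 : ‖a * cexp (2 * (Real.pi : ℂ) * I * (mu : ℂ) * z) * (1 - φ (s - v))‖ ≤ ε / 2 := by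
      rw [norm_mul]
      calc _ ≤ K * (ε / (2 * (K + 1))) := by gcongr
        _ ≤ (K + 1) * (ε / (2 * (K + 1))) := by gcongr; linarith
        _ = ε / 2 := by field_simp
    have h10 : f z + a * cexp (2 * (Real.pi : ℂ) * I * (mu : ℂ) * z) -
        (f (z + ((s - v : ℝ) : ℂ)) +
          a * cexp (2 * (Real.pi : ℂ) * I * (mu : ℂ) * (z + ((s - v : ℝ) : ℂ)))) =
        (f z - f (z + ((s - v : ℝ) : ℂ))) +
          a * cexp (2 * (Real.pi : ℂ) * I * (mu : ℂ) * z) * (1 - φ (s - v)) := by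
      simp only [hφ]
      rw [mul_add (2 * (Real.pi : ℂ) * I * (mu : ℂ)), exp_add]
      ring
    rw [h10]
    refine (norm_add_le _ _).trans ?_
    linarith

theorem APH.add_trigEval {f : ℂ → ℂ} (hf : APH f) (Q : AddMonoidAlgebra ℂ ℝ) :
    APH fun z => f z + trigEval z Q := by
  induction Q using AddMonoidAlgebra.induction_linear generalizing f with
  | zero => simpa using hf
  | add P Q hP hQ => simpa only [map_add, add_assoc] using hQ (hP hf)
  | single m r => simpa only [trigEval_single] using hf.add_cexp m r

theorem norm_inv_sub_geom_sum_le {p r : ℂ} (hp : ‖p‖ ≤ 1 / 4) (hr : ‖r‖ ≤ 1 / 4) (N : ℕ) :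
    ‖(1 + p + r)⁻¹ - ∑ n ∈ Finset.range N, (-p) ^ n‖ ≤ 2 * (‖p‖ ^ N + 2 * ‖r‖) := by
  set S := ∑ n ∈ Finset.range N, (-p) ^ n with hS
  have hSn : ‖S‖ ≤ 2 := by
    refine (norm_sum_le _ _).trans ?_
    calc ∑ n ∈ Finset.range N, ‖(-p) ^ n‖ ≤ ∑ n ∈ Finset.range N, (1 / 2 : ℝ) ^ n := by
          refine Finset.sum_le_sum fun n _ => ?_
          rw [norm_pow, norm_neg]
          gcongr
          linarith
      _ ≤ 2 := sum_geometric_two_le N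
  have hu : 1 / 2 ≤ ‖1 + p + r‖ := by
    have h1 : (1 : ℂ) = (1 + p + r) - p - r := by ring
    have h2 := norm_sub_le ((1 + p + r) - p) r
    have h3 := norm_sub_le (1 + p + r) p
    rw [← h1, norm_one] at h2
    linarith
  have hu0 : 1 + p + r ≠ 0 := fun h => by
    rw [h, norm_zero] at hu
    norm_num at hu
  have hgeom : S * (1 + p) = 1 - (-p) ^ N := by
    have := geom_sum_mul_neg (-p) N
    rwa [sub_neg_eq_add] at this
  have h : (1 + p + r)⁻¹ - S = ((-p) ^ N - r * S) / (1 + p + r) := by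
    rw [eq_div_iff hu0, sub_mul, inv_mul_cancel₀ hu0]
    linear_combination -hgeom
  rw [h, norm_div, div_le_iff₀ (by linarith)]
  have h1 : ‖(-p) ^ N - r * S‖ ≤ ‖p‖ ^ N + 2 * ‖r‖ := by
    refine (norm_sub_le _ _).trans ?_
    rw [norm_pow, norm_neg, norm_mul, mul_comm 2]
    gcongr
  have h2 : 0 ≤ ‖p‖ ^ N + 2 * ‖r‖ := by positivity
  nlinarith

/-- The Fourier coefficients along an ultrafilter exist for every bounded function. -/
theorem APH.exists_tendsto_lineMean {f : ℂ → ℂ} (hf : APH f) {U : Ultrafilter ℝ}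
    (hU : (U : Filter ℝ) ≤ atTop) (lam : ℝ) :
    ∃ a : ℂ, Tendsto (lineMean f 1 lam) U (𝓝 a) := by
  obtain ⟨M, hM, hb⟩ := (hf.apr_line one_pos).exists_norm_le
  have hmem : ∀ᶠ T in (U : Filter ℝ), lineMean f 1 lam T ∈
      Metric.closedBall (0 : ℂ) (M * Real.exp (2 * Real.pi * lam * 1)) := by
    filter_upwards [(eventually_gt_atTop (0 : ℝ)).filter_mono hU] with T hT
    rw [mem_closedBall_zero_iff]
    exact norm_lineMean_le hT hb
  obtain ⟨a, -, ha⟩ := (isCompact_closedBall (0 : ℂ)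
    (M * Real.exp (2 * Real.pi * lam * 1))).ultrafilter_le_nhds' (U.map (lineMean f 1 lam)) hmem
  exact ⟨a, ha⟩

theorem norm_trigEval_sum_le (F : Finset ℝ) (a : ℝ → ℂ) {b : ℝ} (hb : ∀ mu ∈ F, b ≤ mu) {z : ℂ}
    (hz : 0 ≤ z.im) : ‖trigEval z (∑ mu ∈ F, AddMonoidAlgebra.single mu (a mu))‖ ≤
      (∑ mu ∈ F, ‖a mu‖) * Real.exp (-(2 * Real.pi * b * z.im)) := by
  have hπ := Real.pi_pos
  rw [map_sum, Finset.sum_mul]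
  refine norm_sum_le_of_le _ fun mu hmu => ?_
  rw [trigEval_single, norm_mul, norm_cexp_two_pi_mul]
  gcongr
  exact hb mu hmu

/-- If `f` is the sum of a leading exponential, a finite sum of exponentials with larger
frequencies and a small error, then `1 / f` is a trigonometric polynomial up to a small error. -/
theorem exists_trigEval_inv {f : ℂ → ℂ} {a₀ : ℂ} (ha₀ : a₀ ≠ 0) {lam₀ d B C Cp : ℝ} (hd : 0 < d)
    (hB : lam₀ < B) (P : AddMonoidAlgebra ℂ ℝ)
    (hP : ∀ z : ℂ, 0 ≤ z.im →
      ‖trigEval z P‖ ≤ Cp * Real.exp (-(2 * Real.pi * (lam₀ + d) * z.im)))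
    (h : ∀ z : ℂ, 1 ≤ z.im →
      ‖f z - trigEval z (AddMonoidAlgebra.single lam₀ a₀ + P)‖ ≤
        C * Real.exp (-(2 * Real.pi * B * z.im))) :
    ∃ (Q : AddMonoidAlgebra ℂ ℝ) (C' Y : ℝ), ∀ z : ℂ, Y ≤ z.im →
      ‖(f z)⁻¹ - trigEval z Q‖ ≤ C' * Real.exp (-(2 * Real.pi * (B - 2 * lam₀) * z.im)) := by
  have hπ := Real.pi_pos
  obtain ⟨N, hN⟩ := exists_nat_ge ((B - lam₀) / d)
  rw [div_le_iff₀ hd] at hN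
  set E : AddMonoidAlgebra ℂ ℝ := AddMonoidAlgebra.single (-lam₀) a₀⁻¹ with hE
  have hA : 0 < ‖a₀‖⁻¹ := by positivity
  have hEn : ∀ z, ‖trigEval z E‖ = ‖a₀‖⁻¹ * Real.exp (2 * Real.pi * lam₀ * z.im) := fun z => by
    rw [hE, trigEval_single, norm_mul, norm_inv, norm_cexp_two_pi_mul]
    ring_nf
  have hE0 : ∀ z, trigEval z E ≠ 0 := fun z => by
    rw [← norm_pos_iff, hEn]
    positivity
  have hE1 : ∀ z, trigEval z (AddMonoidAlgebra.single lam₀ a₀) * trigEval z E = 1 := fun z => by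
    rw [← map_mul, hE, AddMonoidAlgebra.single_mul_single, add_neg_cancel, mul_inv_cancel₀ ha₀,
      trigEval_single]
    simp
  have hC0 : 0 ≤ C := nonneg_of_mul_nonneg_left ((norm_nonneg _).trans (h I (by simp)))
    (Real.exp_pos _)
  have hCp0 : 0 ≤ Cp := nonneg_of_mul_nonneg_left ((norm_nonneg _).trans (hP I (by simp)))
    (Real.exp_pos _)
  set p : ℂ → ℂ := fun z => trigEval z (P * E) with hp
  set r : ℂ → ℂ := fun z => (f z - trigEval z (AddMonoidAlgebra.single lam₀ a₀ + P)) *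
    trigEval z E with hr
  have hpn : ∀ z : ℂ, 0 ≤ z.im →
      ‖p z‖ ≤ Cp * ‖a₀‖⁻¹ * Real.exp (-(2 * Real.pi * d) * z.im) := fun z hz => by
    simp only [hp]
    rw [map_mul, norm_mul, hEn]
    refine (mul_le_mul_of_nonneg_right (hP z hz) (by positivity)).trans_eq ?_
    rw [mul_mul_mul_comm, ← Real.exp_add]
    ring_nf
  have hrn : ∀ z : ℂ, 1 ≤ z.im →
      ‖r z‖ ≤ C * ‖a₀‖⁻¹ * Real.exp (-(2 * Real.pi * (B - lam₀)) * z.im) := fun z hz => by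
    rw [hr, norm_mul, hEn]
    refine (mul_le_mul_of_nonneg_right (h z hz) (by positivity)).trans_eq ?_
    rw [mul_mul_mul_comm, ← Real.exp_add]
    ring_nf
  have hlim : ∀ K b : ℝ, 0 < b → ∀ᶠ y : ℝ in atTop, K * Real.exp (-(2 * Real.pi * b) * y) < 1 / 4 := by
    intro K b hb
    have h1 : Tendsto (fun y : ℝ => Real.exp (-(2 * Real.pi * b) * y)) atTop (𝓝 0) :=
      Real.tendsto_exp_atBot.comp (tendsto_id.const_mul_atTop_of_neg (by
        rw [neg_lt_zero]; positivity))
    have h2 := h1.const_mul K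
    rw [mul_zero] at h2
    exact h2.eventually_lt_const (by norm_num)
  obtain ⟨Y, hY⟩ := eventually_atTop.1 ((hlim (Cp * ‖a₀‖⁻¹) d hd).and
    (hlim (C * ‖a₀‖⁻¹) (B - lam₀) (by linarith)))
  refine ⟨E * ∑ n ∈ Finset.range N, (-(P * E)) ^ n,
    ‖a₀‖⁻¹ * (2 * ((Cp * ‖a₀‖⁻¹) ^ N + 2 * (C * ‖a₀‖⁻¹))), max Y 1, fun z hz => ?_⟩
  have hz1 : 1 ≤ z.im := (le_max_right _ _).trans hz
  obtain ⟨h1, h2⟩ := hY z.im ((le_max_left _ _).trans hz)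
  have hp1 := hpn z (by linarith)
  have hr1 := hrn z hz1
  have hgeom := norm_inv_sub_geom_sum_le (hp1.trans h1.le) (hr1.trans h2.le) N
  have hfE : f z * trigEval z E = 1 + p z + r z := by
    simp only [hp, hr, map_add, map_mul]
    linear_combination hE1 z
  have hfz : (f z)⁻¹ - trigEval z (E * ∑ n ∈ Finset.range N, (-(P * E)) ^ n) =
      trigEval z E * ((1 + p z + r z)⁻¹ - ∑ n ∈ Finset.range N, (-p z) ^ n) := by
    rw [← hfE, mul_inv, mul_sub, mul_left_comm, mul_inv_cancel₀ (hE0 z), mul_one, map_mul, map_sum]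
    simp only [hp, map_pow, map_neg]
  set X := Real.exp (-(2 * Real.pi * (B - lam₀)) * z.im) with hX
  have hpN : ‖p z‖ ^ N ≤ (Cp * ‖a₀‖⁻¹) ^ N * X := by
    refine (pow_le_pow_left₀ (norm_nonneg _) hp1 N).trans ?_
    rw [mul_pow, ← Real.exp_nat_mul]
    refine mul_le_mul_of_nonneg_left (Real.exp_le_exp.2 ?_) (by positivity)
    have : 2 * Real.pi * (B - lam₀) * z.im ≤ 2 * Real.pi * (N * d) * z.im := by gcongr
    linarith
  rw [hfz, norm_mul, hEn]
  calc ‖a₀‖⁻¹ * Real.exp (2 * Real.pi * lam₀ * z.im) *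
        ‖(1 + p z + r z)⁻¹ - ∑ n ∈ Finset.range N, (-p z) ^ n‖
      ≤ ‖a₀‖⁻¹ * Real.exp (2 * Real.pi * lam₀ * z.im) *
        (2 * ((Cp * ‖a₀‖⁻¹) ^ N * X + 2 * (C * ‖a₀‖⁻¹ * X))) := by
        gcongr
        exact hgeom.trans (by gcongr)
    _ = ‖a₀‖⁻¹ * (2 * ((Cp * ‖a₀‖⁻¹) ^ N + 2 * (C * ‖a₀‖⁻¹))) *
        (Real.exp (2 * Real.pi * lam₀ * z.im) * X) := by ring
    _ = _ := by
        rw [hX, ← Real.exp_add]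
        ring_nf

theorem APH.locFinSet_specH_inv {f : ℂ → ℂ} (hf : APH f) (hnz : ∀ z ∈ UHP, f z ≠ 0)
    (hbdd : BddBelow (specH f)) (hfin : LocFinSet (specH f)) :
    LocFinSet (specH fun z => (f z)⁻¹) := by
  obtain ⟨B₀, hB₀⟩ := hbdd
  have hU : ((Ultrafilter.of (atTop : Filter ℝ)) : Filter ℝ) ≤ atTop := Ultrafilter.of_le _
  set U := Ultrafilter.of (atTop : Filter ℝ) with hUdef
  choose a ha using fun lam => hf.exists_tendsto_lineMean hU lam
  have haspec : ∀ lam, a lam ≠ 0 → lam ∈ specH f := fun lam h => by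
    by_contra hlam
    refine h (tendsto_nhds_unique (ha lam) (Tendsto.mono_left ?_ hU))
    by_contra h0
    exact hlam ⟨1, one_pos, h0⟩
  have hSfin : ∀ b, {lam | a lam ≠ 0 ∧ lam < b}.Finite := fun b =>
    (hfin (B₀ - 1) b).subset fun lam hlam =>
      ⟨haspec _ hlam.1, by linarith [hB₀ (haspec _ hlam.1)], hlam.2⟩
  have hne : ∃ lam, a lam ≠ 0 := by
    by_contra! h0
    obtain ⟨C, hC, h1⟩ := hf.norm_le_of_lowerBound hB₀
    obtain ⟨C', hC', B', h2⟩ := hf.norm_inv_le hnz hC h1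
    obtain ⟨K, hK, h3⟩ := hf.norm_le_of_means hU (B := 1 - B') fun lam _ => h0 lam ▸ ha lam
    have h4 : ∀ y : ℝ, 2 ≤ y → 1 ≤ K * C' * Real.exp (-(2 * Real.pi) * y) := by
      intro y hy
      have e1 := h3 (y * I) (by simp; linarith)
      have e2 := h2 (y * I) (by simpa using hy)
      have e3 : f (y * I) ≠ 0 := hnz _ (by simp [UHP]; linarith)
      have e4 : (y * I : ℂ).im = y := by simp
      rw [e4] at e1 e2
      calc (1 : ℝ) = ‖f (y * I)‖ * ‖(f (y * I))⁻¹‖ := by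
            rw [← norm_mul, mul_inv_cancel₀ e3, norm_one]
        _ ≤ K * Real.exp (-(2 * Real.pi * (1 - B') * y)) *
            (C' * Real.exp (-(2 * Real.pi * B' * y))) := by gcongr
        _ = _ := by
            rw [mul_mul_mul_comm, ← Real.exp_add]
            ring_nf
    have h5 : Tendsto (fun y : ℝ => K * C' * Real.exp (-(2 * Real.pi) * y)) atTop (𝓝 (K * C' * 0)) :=
      (Real.tendsto_exp_atBot.comp (tendsto_id.const_mul_atTop_of_neg (by
        have := Real.pi_pos
        linarith))).const_mul _
    have h6 := ge_of_tendsto h5 (eventually_atTop.2 ⟨2, h4⟩)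
    norm_num at h6
  obtain ⟨lam₁, h₁⟩ := hne
  obtain ⟨lam₀, ⟨ha₀, hlt⟩, hmin⟩ := exists_min_image _ id (hSfin (lam₁ + 1))
    ⟨lam₁, h₁, by linarith⟩
  have hlow : ∀ lam < lam₀, a lam = 0 := fun lam hlam => by
    by_contra h
    exact (hmin lam ⟨h, hlam.trans hlt⟩).not_gt hlam
  intro α b
  set B := max (b + 2 * lam₀) (lam₀ + 1) with hB
  have hB1 : lam₀ < B := lt_of_lt_of_le (by linarith) (le_max_right _ _)
  have hFfin : {lam | a lam ≠ 0 ∧ lam₀ < lam ∧ lam < B}.Finite :=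
    (hSfin B).subset fun lam h => ⟨h.1, h.2.2⟩
  set F := hFfin.toFinset with hF
  have hmemF : ∀ lam, lam ∈ F ↔ a lam ≠ 0 ∧ lam₀ < lam ∧ lam < B := fun lam => by simp [hF]
  obtain ⟨d, hd, hdF⟩ : ∃ d > 0, ∀ mu ∈ F, lam₀ + d ≤ mu := by
    rcases F.eq_empty_or_nonempty with h | h
    · exact ⟨1, one_pos, by simp [h]⟩
    · obtain ⟨mu, hmu, h'⟩ := F.exists_min_image id h
      refine ⟨mu - lam₀, sub_pos.2 ((hmemF mu).1 hmu).2.1, fun nu hnu => ?_⟩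
      have := h' nu hnu
      simp only [id] at this
      linarith
  set P : AddMonoidAlgebra ℂ ℝ := ∑ mu ∈ F, AddMonoidAlgebra.single mu (a mu) with hP
  have hcoeff : ∀ lam < B, (AddMonoidAlgebra.single lam₀ (a lam₀) + P).coeff lam = a lam := by
    intro lam hlam
    have h1 : P.coeff lam = if lam ∈ F then a lam else 0 := by
      rw [hP, AddMonoidAlgebra.coeff_sum, Finsupp.finsetSum_apply]
      simp only [AddMonoidAlgebra.coeff_single, Finsupp.single_apply]
      rw [Finset.sum_ite_eq' F lam a]
    rw [AddMonoidAlgebra.coeff_add, Finsupp.add_apply, h1, AddMonoidAlgebra.coeff_single,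
      Finsupp.single_apply]
    rcases lt_trichotomy lam lam₀ with h | h | h
    · simp [hmemF, h.ne', hlow lam h]
    · simp [hmemF, h]
    · by_cases h0 : a lam = 0
      · simp [hmemF, h0, h.ne]
      · simp [hmemF, h0, h.ne, h, hlam]
  set R := AddMonoidAlgebra.single lam₀ (a lam₀) + P with hR
  obtain ⟨C, -, hC⟩ := (hf.add_trigEval (-R)).norm_le_of_means hU (B := B) (by
    intro lam hlam
    have h1 := (ha lam).add ((tendsto_lineMean_trigEval (-R) one_pos lam).mono_left hU)
    have h2 : a lam + (-R).coeff lam = 0 := by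
      rw [AddMonoidAlgebra.coeff_neg, Finsupp.neg_apply, hcoeff lam hlam, add_neg_cancel]
    rw [h2] at h1
    exact h1.congr fun T => (lineMean_add hf.1.continuousOn
      (differentiable_trigEval _).continuous.continuousOn one_pos lam T).symm)
  obtain ⟨Q, C', Y, hQ⟩ := exists_trigEval_inv ha₀ hd hB1 P
    (fun z hz => norm_trigEval_sum_le F a hdF hz) (C := C) (f := f) (fun z hz => by
      have := hC z hz
      rwa [map_neg, ← sub_eq_add_neg] at this)
  refine Q.coeff.support.finite_toSet.subset fun lam hlam => ?_
  refine specH_subset_of_norm_sub_trigEval_le (hf.inv hnz) Q hQ hlam.1 (hlam.2.2.trans_le ?_)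
  linarith [le_max_left (b + 2 * lam₀) (lam₀ + 1)]

/-- Lemma 5.2(iv): a nonvanishing `f ∈ AP(ℍ)` is bounded away from zero on strips,
`1/f ∈ AP(ℍ)`, and spectral bounds/local finiteness are inherited by `1/f`. -/
theorem stmt16 (f : ℂ → ℂ) (hf : APH f) (hnz : ∀ z ∈ UHP, f z ≠ 0) :
    (∀ ε > (0:ℝ), ∃ c > (0:ℝ), ∀ z : ℂ, ε < z.im → z.im < 1/ε → c ≤ ‖f z‖) ∧
    APH (fun z => (f z)⁻¹) ∧
    (BddBelow (specH f) → BddBelow (specH fun z => (f z)⁻¹)) ∧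
    (BddBelow (specH f) → LocFinSet (specH f) → LocFinSet (specH fun z => (f z)⁻¹)) := by
  refine ⟨fun ε hε => ?_, hf.inv hnz, hf.bddBelow_specH_inv hnz, hf.locFinSet_specH_inv hnz⟩
  rcases lt_or_ge ε (1 / ε) with h | h
  · obtain ⟨c, hc, hb⟩ := hf.exists_le_norm hnz hε h
    exact ⟨c, hc, fun z h1 h2 => hb z h1.le h2.le⟩
  · exact ⟨1, one_pos, fun z h1 h2 => absurd (h1.trans h2) h.not_gt⟩
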